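/- For every binary pattern P, the following three statements are equivalent: the class Av(P) is row-bounded; the class Av(P) is column-bounded; the class Av(P) is bounded. -/

import Mathlib

/-!
Common framework: binary matrices, interval minors, criticality, 0-runs,
row/column complexity, embeddings and related notions, following
Jelínek–Kučera, "On the structure of matrices avoiding interval-minor
patterns". All indices are 0-based.
-/

/-- A binary matrix: dimensions `m × n`, with entries given by a total
function (entries outside the range `[0,m) × [0,n)` are irrelevant:
all definitions below only inspect in-range entries). -/
structure BMat where
  m : ℕ
  n : ℕ
  entry : ℕ → ℕ → Bool

namespace BMat

/-- The support of a binary matrix: its set of (in-range) 1-entries. -/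
def supp (M : BMat) : Set (ℕ × ℕ) :=
  {p | p.1 < M.m ∧ p.2 < M.n ∧ M.entry p.1 p.2 = true}

/-- `M'` is obtained from `M` by contracting two adjacent rows `r`, `r+1`. -/
def RowCon (M M' : BMat) : Prop :=
  ∃ r, r + 1 < M.m ∧ M'.m + 1 = M.m ∧ M'.n = M.n ∧
    ∀ i j, i < M'.m → j < M'.n →
      M'.entry i j =
        if i < r then M.entry i j
        else if i = r then (M.entry r j || M.entry (r + 1) j)
        else M.entry (i + 1) j

/-- `M'` is obtained from `M` by contracting two adjacent columns `c`, `c+1`. -/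
def ColCon (M M' : BMat) : Prop :=
  ∃ c, c + 1 < M.n ∧ M'.n + 1 = M.n ∧ M'.m = M.m ∧
    ∀ i j, i < M'.m → j < M'.n →
      M'.entry i j =
        if j < c then M.entry i j
        else if j = c then (M.entry i c || M.entry i (c + 1))
        else M.entry i (j + 1)

/-- One contraction step (of a row or of a column). -/
def Con (M M' : BMat) : Prop := RowCon M M' ∨ ColCon M M'

/-- `P` is an interval minor of `M`: `M` can be transformed by a sequence of
row and column contractions into a matrix of the same dimensions as `P`
dominating `P`. -/
def IntervalMinor (P M : BMat) : Prop :=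
  ∃ M', Relation.ReflTransGen Con M M' ∧ M'.m = P.m ∧ M'.n = P.n ∧
    ∀ i j, i < P.m → j < P.n → P.entry i j = true → M'.entry i j = true

/-- `M` avoids `P` as an interval minor. -/
def Avoids (P M : BMat) : Prop := ¬ IntervalMinor P M

/-- The class of all matrices avoiding `P` as an interval minor. -/
def Av (P : BMat) : Set BMat := {M | Avoids P M}

/-- The class of all matrices avoiding every pattern of `F` as an interval
minor. -/
def AvF (F : Set BMat) : Set BMat := {M | ∀ P ∈ F, Avoids P M}

/-- The matrix obtained from `M` by changing the entry at position `(i, j)`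
into a 1-entry. -/
def setOne (M : BMat) (i j : ℕ) : BMat :=
  ⟨M.m, M.n, fun a b => if a = i ∧ b = j then true else M.entry a b⟩

/-- `M` is critical for the class `C`: it lies in `C`, but changing any
single 0-entry of `M` into a 1-entry leaves `C`. -/
def CriticalFor (C : Set BMat) (M : BMat) : Prop :=
  M ∈ C ∧ ∀ i j, i < M.m → j < M.n → M.entry i j = false → setOne M i j ∉ C

/-- The number of horizontal 0-runs in row `r` of `M`, counted via their
starting columns. -/
noncomputable def rowRunCount (M : BMat) (r : ℕ) : ℕ :=
  Set.ncard {j | j < M.n ∧ M.entry r j = false ∧ (j = 0 ∨ M.entry r (j - 1) = true)}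

/-- The number of vertical 0-runs in column `c` of `M`. -/
noncomputable def colRunCount (M : BMat) (c : ℕ) : ℕ :=
  Set.ncard {i | i < M.m ∧ M.entry i c = false ∧ (i = 0 ∨ M.entry (i - 1) c = true)}

/-- A class is row-bounded if there is a uniform bound on the number of
0-runs in any row of any matrix that is critical for the class. -/
def RowBounded (C : Set BMat) : Prop :=
  ∃ K, ∀ M, CriticalFor C M → ∀ r, r < M.m → rowRunCount M r ≤ K

/-- A class is column-bounded if there is a uniform bound on the number of
0-runs in any column of any matrix that is critical for the class. -/
def ColBounded (C : Set BMat) : Prop :=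
  ∃ K, ∀ M, CriticalFor C M → ∀ c, c < M.n → colRunCount M c ≤ K

/-- A class is bounded if it is both row-bounded and column-bounded. -/
def Bounded (C : Set BMat) : Prop := RowBounded C ∧ ColBounded C

/-- The pattern `Q₁`, with support `{(1,2),(2,1),(3,3)}` (1-based). -/
def Q1 : BMat :=
  ⟨3, 3, fun i j => (i == 0 && j == 1) || (i == 1 && j == 0) || (i == 2 && j == 2)⟩

/-- The pattern `Q₂`, with support `{(1,2),(2,3),(3,1)}` (1-based). -/
def Q2 : BMat :=
  ⟨3, 3, fun i j => (i == 0 && j == 1) || (i == 1 && j == 2) || (i == 2 && j == 0)⟩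

/-- The pattern `Q₃`, with support `{(1,1),(2,3),(3,2)}` (1-based). -/
def Q3 : BMat :=
  ⟨3, 3, fun i j => (i == 0 && j == 0) || (i == 1 && j == 2) || (i == 2 && j == 1)⟩

/-- The pattern `Q₄`, with support `{(1,3),(2,1),(3,2)}` (1-based). -/
def Q4 : BMat :=
  ⟨3, 3, fun i j => (i == 0 && j == 2) || (i == 1 && j == 0) || (i == 2 && j == 1)⟩

/-- The diagonal pattern `D_k`, with support `{(i,i) : i ∈ [k]}`. -/
def D (k : ℕ) : BMat := ⟨k, k, fun i j => i == j⟩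

/-- The antidiagonal pattern `D̄_k`, with support `{(i, k+1-i) : i ∈ [k]}`
(1-based). -/
def Dbar (k : ℕ) : BMat := ⟨k, k, fun i j => i + j + 1 == k⟩

/-- An embedding of `P` into `M`: 1-entries go to 1-entries, and the map is
strictly monotone in rows and in columns. -/
def IsEmbedding (P M : BMat) (φ : ℕ → ℕ → ℕ × ℕ) : Prop :=
  (∀ i j, i < P.m → j < P.n → (φ i j).1 < M.m ∧ (φ i j).2 < M.n) ∧
  (∀ i j, i < P.m → j < P.n → P.entry i j = true →
      M.entry (φ i j).1 (φ i j).2 = true) ∧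
  (∀ i₁ j₁ i₂ j₂, i₁ < P.m → j₁ < P.n → i₂ < P.m → j₂ < P.n →
      (i₁ < i₂ → (φ i₁ j₁).1 < (φ i₂ j₂).1) ∧
      (j₁ < j₂ → (φ i₁ j₁).2 < (φ i₂ j₂).2))

/-- A partition of `M` containing `P` (via row indices `r 0 < ⋯ < r P.m ≤ M.m`
and column indices `c 0 < ⋯ < c P.n ≤ M.n`). -/
def PartitionContains (M P : BMat) : Prop :=
  ∃ r c : ℕ → ℕ,
    (∀ i, i < P.m → r i < r (i + 1)) ∧ (∀ j, j < P.n → c j < c (j + 1)) ∧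
    r P.m ≤ M.m ∧ c P.n ≤ M.n ∧
    ∀ i j, i < P.m → j < P.n → P.entry i j = true →
      ∃ a b, r i ≤ a ∧ a < r (i + 1) ∧ c j ≤ b ∧ b < c (j + 1) ∧
        M.entry a b = true

/-- A partial embedding of `P` into `M`, defined on a nonempty set `S` of
entries of `P`. -/
def IsPartialEmbedding (P M : BMat) (S : Set (ℕ × ℕ)) (ψ : ℕ × ℕ → ℕ × ℕ) : Prop :=
  S.Nonempty ∧ (∀ e ∈ S, e.1 < P.m ∧ e.2 < P.n) ∧
  (∀ i j, i < P.m → j < P.n → P.entry i j = true →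
      (i, j) ∈ S ∧ M.entry (ψ (i, j)).1 (ψ (i, j)).2 = true) ∧
  (∀ e ∈ S, (ψ e).1 < M.m ∧ (ψ e).2 < M.n ∧
      e.1 ≤ (ψ e).1 ∧ e.2 ≤ (ψ e).2 ∧
      P.m - 1 - e.1 ≤ M.m - 1 - (ψ e).1 ∧ P.n - 1 - e.2 ≤ M.n - 1 - (ψ e).2) ∧
  (∀ e₁ ∈ S, ∀ e₂ ∈ S,
      (e₁.1 < e₂.1 → e₂.1 - e₁.1 ≤ (ψ e₂).1 - (ψ e₁).1) ∧
      (e₁.2 < e₂.2 → e₂.2 - e₁.2 ≤ (ψ e₂).2 - (ψ e₁).2))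

/-- A horizontal 0-run of `M` in row `r`, occupying exactly columns
`c₁, …, c₂`. -/
def ZeroRun (M : BMat) (r c₁ c₂ : ℕ) : Prop :=
  r < M.m ∧ c₁ ≤ c₂ ∧ c₂ < M.n ∧
  (∀ j, c₁ ≤ j → j ≤ c₂ → M.entry r j = false) ∧
  (c₁ = 0 ∨ M.entry r (c₁ - 1) = true) ∧
  (c₂ + 1 = M.n ∨ M.entry r (c₂ + 1) = true)

/-- The 0-entry `f` of `M` is critical for the 1-entry `e` of `P`: some
embedding of `P` into `M △ f` maps `e` to `f`. -/
def CritEntry (P : BMat) (e : ℕ × ℕ) (M : BMat) (f : ℕ × ℕ) : Prop :=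
  f.1 < M.m ∧ f.2 < M.n ∧ M.entry f.1 f.2 = false ∧
  ∃ φ, IsEmbedding P (setOne M f.1 f.2) φ ∧ φ e.1 e.2 = f

/-- The number of horizontal 0-runs in row `r` of `M` that are critical for
the 1-entry `e` of `P` (counted via their starting columns). -/
noncomputable def critRunCount (P : BMat) (e : ℕ × ℕ) (M : BMat) (r : ℕ) : ℕ :=
  Set.ncard {c₁ | ∃ c₂, ZeroRun M r c₁ c₂ ∧
    ∃ c, c₁ ≤ c ∧ c ≤ c₂ ∧ CritEntry P e M (r, c)}

/-- The 1-entry `e` of `P` is row-bounding: every row of every `P`-avoiding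
matrix contains a bounded number of 0-runs critical for `e`. -/
def EntryRowBounding (P : BMat) (e : ℕ × ℕ) : Prop :=
  ∃ K, ∀ M, Avoids P M → ∀ r, critRunCount P e M r ≤ K

/-- An increasing walk from `e` to `e'`: a sequence of positions, each step
moving one column to the right or one row up, with `W` its set of
positions. -/
def IsIncreasingWalk (W : Set (ℕ × ℕ)) (e e' : ℕ × ℕ) : Prop :=
  ∃ (t : ℕ) (f : ℕ → ℕ × ℕ), f 0 = e ∧ f t = e' ∧
    W = {x | ∃ i, i ≤ t ∧ f i = x} ∧
    ∀ i, i < t →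
      ((f (i + 1)).1 = (f i).1 ∧ (f (i + 1)).2 = (f i).2 + 1) ∨
      ((f (i + 1)).1 + 1 = (f i).1 ∧ (f (i + 1)).2 = (f i).2)

/-- All 1-entries of `P` can be covered by at most `k` lines
(rows or columns). -/
def CoveredByLines (P : BMat) (k : ℕ) : Prop :=
  ∃ (R C : Finset ℕ), R.card + C.card ≤ k ∧
    ∀ i j, i < P.m → j < P.n → P.entry i j = true → i ∈ R ∨ j ∈ C

/-- Clockwise rotation by 90 degrees. -/
def rot90 (P : BMat) : BMat := ⟨P.n, P.m, fun i j => P.entry (P.m - 1 - j) i⟩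

/-- Rotation by 180 degrees. -/
def rot180 (P : BMat) : BMat :=
  ⟨P.m, P.n, fun i j => P.entry (P.m - 1 - i) (P.n - 1 - j)⟩

/-- Clockwise rotation by 270 degrees. -/
def rot270 (P : BMat) : BMat := ⟨P.n, P.m, fun i j => P.entry j (P.n - 1 - i)⟩

/-- Reflection turning the matrix upside down (reversing the rows). -/
def reflRows (P : BMat) : BMat := ⟨P.m, P.n, fun i j => P.entry (P.m - 1 - i) j⟩

/-- Reflection reversing the columns. -/
def reflCols (P : BMat) : BMat := ⟨P.m, P.n, fun i j => P.entry i (P.n - 1 - j)⟩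

/-- Reflection along the main diagonal (transposition). -/
def transposeB (P : BMat) : BMat := ⟨P.n, P.m, fun i j => P.entry j i⟩

/-- Reflection along the antidiagonal. -/
def antitransposeB (P : BMat) : BMat :=
  ⟨P.n, P.m, fun i j => P.entry (P.m - 1 - j) (P.n - 1 - i)⟩

/-- Type 1 pattern of Lemma `lem-2types`: rows `r < r' < r''`, columns
`c < c'`, with `supp ⊆ ({r'} × [c,c']) ∪ {(r,c),(r'',c),(r,c'),(r'',c')}`. -/
def TypeOne (P₀ : BMat) : Prop :=
  ∃ r r' r'' c c', r < r' ∧ r' < r'' ∧ r'' < P₀.m ∧ c < c' ∧ c' < P₀.n ∧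
    ∀ i j, i < P₀.m → j < P₀.n → P₀.entry i j = true →
      (i = r' ∧ c ≤ j ∧ j ≤ c') ∨ ((i = r ∨ i = r'') ∧ (j = c ∨ j = c'))

/-- Type 2 pattern of Lemma `lem-2types`: rows `r < r'`, columns `c < c'`,
with `supp ⊆ ({r} × [c,c']) ∪ ({r'} × [1,c]) ∪ ([1,r] × {c'}) ∪ {(r',c')}`. -/
def TypeTwo (P₀ : BMat) : Prop :=
  ∃ r r' c c', r < r' ∧ r' < P₀.m ∧ c < c' ∧ c' < P₀.n ∧
    ∀ i j, i < P₀.m → j < P₀.n → P₀.entry i j = true →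
      (i = r ∧ c ≤ j ∧ j ≤ c') ∨ (i = r' ∧ j ≤ c) ∨ (i ≤ r ∧ j = c') ∨
      (i = r' ∧ j = c')

/-- A minor-closed class of binary matrices. -/
def MinorClosed (C : Set BMat) : Prop :=
  ∀ M ∈ C, ∀ P, IntervalMinor P M → P ∈ C

/-- The 4×3 pattern with support `{(1,2),(2,1),(3,2),(4,3)}` (1-based), from
Proposition `pro-counter`. -/
def P18 : BMat :=
  ⟨4, 3, fun i j => (i == 0 && j == 1) || (i == 1 && j == 0) ||
    (i == 2 && j == 1) || (i == 3 && j == 2)⟩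

end BMat

open BMat

namespace IMP

structure Pat where
  k : ℤ
  l : ℤ
  E : ℤ → ℤ → Prop
  hE : ∀ s d, E s d → 0 ≤ s ∧ s < k ∧ 0 ≤ d ∧ d < l

def Cuts (k t b : ℤ) (R : ℤ → ℤ) : Prop :=
  (∀ s, 0 ≤ s → s < k → R s < R (s + 1)) ∧ t ≤ R 0 ∧ R k ≤ b

def Cell (S : ℤ → ℤ → Prop) (R C : ℤ → ℤ) (s d : ℤ) : Prop :=
  ∃ y x, R s ≤ y ∧ y < R (s + 1) ∧ C d ≤ x ∧ x < C (d + 1) ∧ S y x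

def Cont (P : Pat) (t b l r : ℤ) (S : ℤ → ℤ → Prop) : Prop :=
  ∃ R C, Cuts P.k t b R ∧ Cuts P.l l r C ∧ ∀ s d, P.E s d → Cell S R C s d

def Near (P : Pat) (t b l r : ℤ) (S : ℤ → ℤ → Prop) (e1 e2 ρ f : ℤ) (R C : ℤ → ℤ) : Prop :=
  Cuts P.k t b R ∧ Cuts P.l l r C ∧
  (∀ s d, P.E s d → ¬ (s = e1 ∧ d = e2) → Cell S R C s d) ∧
  R e1 ≤ ρ ∧ ρ < R (e1 + 1) ∧ C e2 ≤ f ∧ f < C (e2 + 1)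

def Conf (N : ℤ) (P : Pat) (e1 e2 : ℤ) : Prop :=
  P.E e1 e2 ∧ ∃ t b l r S ρ, ∃ f g : ℤ → ℤ, ¬ Cont P t b l r S ∧
    (∀ i, 0 ≤ i → i ≤ N → S ρ (g i)) ∧
    (∀ i, 0 ≤ i → i < N → g i < f i ∧ f i < g (i + 1) ∧
      ∃ R C, Near P t b l r S e1 e2 ρ (f i) R C)

def QF (P : Pat) : Prop :=
  ∀ s1 d1 s2 d2 s3 d3, P.E s1 d1 → P.E s2 d2 → P.E s3 d3 → s1 < s2 → s2 < s3 →
    d1 ≠ d2 → d2 ≠ d3 → d1 ≠ d3 → (d1 < d2 ∧ d2 < d3) ∨ (d3 < d2 ∧ d2 < d1)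

theorem mono_aux (g : ℤ → ℤ) (k : ℤ) (h : ∀ s, 0 ≤ s → s < k → g s < g (s + 1)) :
    ∀ a b, 0 ≤ a → a ≤ b → b ≤ k → g a + (b - a) ≤ g b := by
  intro a b ha hab
  induction b, hab using Int.leInduction with
  | base => intro _; omega
  | succ n hn ih =>
    intro hk
    have := ih (by omega)
    have := h n (by omega) (by omega)
    omega

theorem Cuts.mono {k t b : ℤ} {R : ℤ → ℤ} (h : Cuts k t b R) :
    ∀ a b, 0 ≤ a → a ≤ b → b ≤ k → R a + (b - a) ≤ R b := mono_aux R k h.1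

theorem Cuts.lo {k t b : ℤ} {R : ℤ → ℤ} (h : Cuts k t b R) (a : ℤ) (h0 : 0 ≤ a) (hk : a ≤ k) :
    t + a ≤ R a := by
  have := h.mono 0 a le_rfl h0 hk
  have := h.2.1
  omega

theorem Cuts.hi {k t b : ℤ} {R : ℤ → ℤ} (h : Cuts k t b R) (a : ℤ) (h0 : 0 ≤ a) (hk : a ≤ k) :
    R a + (k - a) ≤ b := by
  have := h.mono a k h0 hk le_rfl
  have := h.2.2
  omega

/-! flips -/

def Pat.V (P : Pat) : Pat := ⟨P.k, P.l, fun s d => P.E (P.k - 1 - s) d, by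
  intro s d h; have := P.hE _ _ h; omega⟩

def Pat.H (P : Pat) : Pat := ⟨P.k, P.l, fun s d => P.E s (P.l - 1 - d), by
  intro s d h; have := P.hE _ _ h; omega⟩

theorem Cuts.flip {k t b : ℤ} {R : ℤ → ℤ} (h : Cuts k t b R) :
    Cuts k (-b) (-t) (fun s => - R (k - s)) := by
  refine ⟨?_, ?_, ?_⟩
  · intro s h0 hk
    have := h.1 (k - (s + 1)) (by omega) (by omega)
    have e : k - (s + 1) + 1 = k - s := by ring
    rw [e] at this
    show - R (k - s) < - R (k - (s + 1))
    omega
  · have := h.2.2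
    show - b ≤ - R (k - 0)
    rw [sub_zero]; omega
  · have := h.2.1
    show - R (k - k) ≤ - t
    rw [sub_self]; omega

theorem Cell.flipV {S : ℤ → ℤ → Prop} {R C : ℤ → ℤ} {s d k : ℤ} (h : Cell S R C (k - 1 - s) d) :
    Cell (fun y x => S (-1 - y) x) (fun s => - R (k - s)) C s d := by
  obtain ⟨y, x, h1, h2, h3, h4, h5⟩ := h
  have e : k - 1 - s + 1 = k - s := by ring
  rw [e] at h2
  have e' : k - (s + 1) = k - 1 - s := by ring
  refine ⟨-1 - y, x, ?_, ?_, h3, h4, ?_⟩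
  · show - R (k - s) ≤ _; omega
  · show _ < - R (k - (s + 1)); rw [e']; omega
  · show S (-1 - (-1 - y)) x
    rw [show -1 - (-1 - y) = y by ring]; exact h5

theorem Cell.flipH {S : ℤ → ℤ → Prop} {R C : ℤ → ℤ} {s d k : ℤ} (h : Cell S R C s (k - 1 - d)) :
    Cell (fun y x => S y (-1 - x)) R (fun s => - C (k - s)) s d := by
  obtain ⟨y, x, h1, h2, h3, h4, h5⟩ := h
  have e : k - 1 - d + 1 = k - d := by ring
  rw [e] at h4
  have e' : k - (d + 1) = k - 1 - d := by ring
  refine ⟨y, -1 - x, h1, h2, ?_, ?_, ?_⟩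
  · show - C (k - d) ≤ _; omega
  · show _ < - C (k - (d + 1)); rw [e']; omega
  · show S y (-1 - (-1 - x))
    rw [show -1 - (-1 - x) = x by ring]; exact h5

theorem Cont.flipV {P : Pat} {t b l r : ℤ} {S : ℤ → ℤ → Prop} (h : Cont P.V t b l r S) :
    Cont P (-b) (-t) l r (fun y x => S (-1 - y) x) := by
  obtain ⟨R, C, hR, hC, hE⟩ := h
  refine ⟨fun s => - R (P.k - s), C, hR.flip, hC, ?_⟩
  intro s d hs
  apply Cell.flipV
  apply hE
  show P.E (P.k - 1 - (P.k - 1 - s)) d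
  rw [show P.k - 1 - (P.k - 1 - s) = s by ring]; exact hs

theorem Cont.flipH {P : Pat} {t b l r : ℤ} {S : ℤ → ℤ → Prop} (h : Cont P.H t b l r S) :
    Cont P t b (-r) (-l) (fun y x => S y (-1 - x)) := by
  obtain ⟨R, C, hR, hC, hE⟩ := h
  refine ⟨R, fun s => - C (P.l - s), hR, hC.flip, ?_⟩
  intro s d hs
  apply Cell.flipH
  apply hE
  show P.E s (P.l - 1 - (P.l - 1 - d))
  rw [show P.l - 1 - (P.l - 1 - d) = d by ring]; exact hs

theorem Conf.flipV {P : Pat} {N e1 e2 : ℤ} (h : Conf N P e1 e2) :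
    Conf N P.V (P.k - 1 - e1) e2 := by
  obtain ⟨he, t, b, l, r, S, ρ, f, g, hc, hg, hf⟩ := h
  refine ⟨?_, -b, -t, l, r, fun y x => S (-1 - y) x, -1 - ρ, f, g, ?_, ?_, ?_⟩
  · show P.E (P.k - 1 - (P.k - 1 - e1)) e2
    rw [show P.k - 1 - (P.k - 1 - e1) = e1 by ring]; exact he
  · intro hc'
    apply hc
    have := hc'.flipV
    simpa using this
  · intro i h0 hN
    show S (-1 - (-1 - ρ)) _
    rw [show -1 - (-1 - ρ) = ρ by ring]; exact hg i h0 hN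
  · intro i h0 hN
    obtain ⟨h1, h2, R, C, hR, hC, hE, h3, h4, h5, h6⟩ := hf i h0 hN
    refine ⟨h1, h2, fun s => - R (P.k - s), C, hR.flip, hC, ?_, ?_, ?_, h5, h6⟩
    · intro s d hs hne
      apply Cell.flipV
      apply hE _ _ hs
      omega
    · show - R (P.k - (P.k - 1 - e1)) ≤ _
      rw [show P.k - (P.k - 1 - e1) = e1 + 1 by ring]; omega
    · show _ < - R (P.k - (P.k - 1 - e1 + 1))
      rw [show P.k - (P.k - 1 - e1 + 1) = e1 by ring]; omega

theorem Conf.flipH {P : Pat} {N e1 e2 : ℤ} (h : Conf N P e1 e2) :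
    Conf N P.H e1 (P.l - 1 - e2) := by
  obtain ⟨he, t, b, l, r, S, ρ, f, g, hc, hg, hf⟩ := h
  refine ⟨?_, t, b, -r, -l, fun y x => S y (-1 - x), ρ, fun i => -1 - f (N - 1 - i),
    fun i => -1 - g (N - i), ?_, ?_, ?_⟩
  · show P.E e1 (P.l - 1 - (P.l - 1 - e2))
    rw [show P.l - 1 - (P.l - 1 - e2) = e2 by ring]; exact he
  · intro hc'
    apply hc
    have := hc'.flipH
    simpa using this
  · intro i h0 hN
    show S ρ (-1 - (-1 - g (N - i)))
    rw [show -1 - (-1 - g (N - i)) = g (N - i) by ring]; exact hg _ (by omega) (by omega)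
  · intro i h0 hN
    obtain ⟨h1, h2, R, C, hR, hC, hE, h3, h4, h5, h6⟩ := hf (N - 1 - i) (by omega) (by omega)
    rw [show N - 1 - i + 1 = N - i by ring] at h2
    have e : N - (i + 1) = N - 1 - i := by ring
    refine ⟨?_, ?_, R, fun s => - C (P.l - s), hR, hC.flip, ?_, h3, h4, ?_, ?_⟩
    · show -1 - g (N - i) < -1 - f (N - 1 - i); omega
    · show -1 - f (N - 1 - i) < -1 - g (N - (i + 1)); rw [e]; omega
    · intro s d hs hne
      apply Cell.flipH
      apply hE _ _ hs
      omega
    · show - C (P.l - (P.l - 1 - e2)) ≤ -1 - f (N - 1 - i)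
      rw [show P.l - (P.l - 1 - e2) = e2 + 1 by ring]; omega
    · show -1 - f (N - 1 - i) < - C (P.l - (P.l - 1 - e2 + 1))
      rw [show P.l - (P.l - 1 - e2 + 1) = e2 by ring]; omega

theorem QF.V {P : Pat} (h : QF P) : QF P.V := by
  intro s1 d1 s2 d2 s3 d3 h1 h2 h3 h12 h23 a b c
  have := h _ _ _ _ _ _ h3 h2 h1 (by omega) (by omega) b.symm a.symm c.symm
  omega

theorem QF.H {P : Pat} (h : QF P) : QF P.H := by
  intro s1 d1 s2 d2 s3 d3 h1 h2 h3 h12 h23 a b c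
  have := h _ _ _ _ _ _ h1 h2 h3 (by omega) (by omega) (by omega) (by omega) (by omega)
  omega

end IMP
namespace IMP

structure Pair (P : Pat) (e1 e2 t b l r : ℤ) (S : ℤ → ℤ → Prop) (ρ f1 f2 : ℤ)
    (R1 C1 R2 C2 G : ℤ → ℤ) : Prop where
  he : P.E e1 e2
  n1 : Near P t b l r S e1 e2 ρ f1 R1 C1
  n2 : Near P t b l r S e1 e2 ρ f2 R2 C2
  g0 : ∀ i, 0 ≤ i → i < P.l → S ρ (G i) ∧ f1 < G i ∧ G i < f2
  g1 : ∀ i, 0 ≤ i → i + 1 < P.l → G i < G (i + 1)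

theorem Near.close {P : Pat} {e1 e2 t b l r : ℤ} {S : ℤ → ℤ → Prop} {ρ f x : ℤ} {R C : ℤ → ℤ}
    (h : Near P t b l r S e1 e2 ρ f R C) (hx : S ρ x) (h1 : C e2 ≤ x) (h2 : x < C (e2 + 1)) :
    Cont P t b l r S := by
  obtain ⟨hR, hC, hE, a1, a2, a3, a4⟩ := h
  refine ⟨R, C, hR, hC, fun s d hs => ?_⟩
  by_cases hc : s = e1 ∧ d = e2
  · obtain ⟨rfl, rfl⟩ := hc
    exact ⟨ρ, x, a1, a2, h1, h2, hx⟩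
  · exact hE s d hs hc

theorem Pair.mix {P : Pat} {e1 e2 t b l r : ℤ} {S : ℤ → ℤ → Prop} {ρ f1 f2 : ℤ}
    {R1 C1 R2 C2 G : ℤ → ℤ} (h : Pair P e1 e2 t b l r S ρ f1 f2 R1 C1 R2 C2 G)
    (R : ℤ → ℤ) (dL dR : ℤ) (h0 : 0 ≤ dL) (hL : dL ≤ e2) (hR : e2 < dR) (hl : dR ≤ P.l)
    (hcut : Cuts P.k t b R) (hρ : R e1 ≤ ρ) (hρ' : ρ < R (e1 + 1))
    (hE : ∀ s d, P.E s d →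
      (d ≤ dL ∧ ¬ (s = e1 ∧ d = e2) ∧ R s ≤ R1 s ∧ R1 (s + 1) ≤ R (s + 1)) ∨
      (dR ≤ d + 1 ∧ ¬ (s = e1 ∧ d = e2) ∧ R s ≤ R2 s ∧ R2 (s + 1) ≤ R (s + 1)) ∨
      (s = e1 ∧ dL ≤ d ∧ d < dR)) :
    Cont P t b l r S := by
  have he := P.hE _ _ h.he
  by_cases hA : G 0 < C1 (e2 + 1)
  · have := h.g0 0 le_rfl (by omega)
    exact h.n1.close this.1 (by have := h.n1.2.2.2.2.2.1; omega) hA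
  by_cases hB : C2 e2 ≤ G (P.l - 1)
  · have := h.g0 (P.l - 1) (by omega) (by omega)
    exact h.n2.close this.1 hB (by have := h.n2.2.2.2.2.2.2; omega)
  obtain ⟨hR1, hC1, hE1, a1, a2, a3, a4⟩ := h.n1
  obtain ⟨hR2, hC2, hE2, b1, b2, b3, b4⟩ := h.n2
  have g0 := h.g0
  have g1 := h.g1
  have gm := mono_aux G (P.l - 1) (fun s x y => g1 s x (by omega))
  set C : ℤ → ℤ := fun d => if d ≤ dL then C1 d else if d < dR then G (d - dL - 1) + 1 else C2 d
    with hCdef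
  have cL : ∀ d, d ≤ dL → C d = C1 d := by intro d hd; simp [hCdef, hd]
  have cM : ∀ d, dL < d → d < dR → C d = G (d - dL - 1) + 1 := by
    intro d h1 h2; simp [hCdef, h2, not_le.mpr h1]
  have cR : ∀ d, dR ≤ d → C d = C2 d := by
    intro d h1; simp [hCdef, not_lt.mpr h1, show ¬ d ≤ dL by omega]
  have m1 := hC1.mono
  have m2 := hC2.mono
  have q1 := m1 dL e2 h0 hL (by omega)
  have q2 := m2 (e2 + 1) dR (by omega) (by omega) hl
  have q0 := g0 0 le_rfl (by omega)
  refine ⟨R, C, hcut, ⟨?_, ?_, ?_⟩, ?_⟩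
  · intro d hd0 hdl
    rcases lt_trichotomy d dL with hd | hd | hd
    · rw [cL d (by omega), cL (d + 1) (by omega)]; exact hC1.1 d hd0 hdl
    · subst hd
      rw [cL d le_rfl]
      by_cases hx : d + 1 < dR
      · rw [cM _ (by omega) hx, show d + 1 - d - 1 = 0 by ring]; omega
      · have : d + 1 = dR := by omega
        rw [cR _ (by omega), this]; omega
    · by_cases hx : d < dR
      · rw [cM d hd hx]
        by_cases hx' : d + 1 < dR
        · rw [cM _ (by omega) hx', show d + 1 - dL - 1 = d - dL - 1 + 1 by ring]
          have := g1 (d - dL - 1) (by omega) (by omega)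
          omega
        · have : d + 1 = dR := by omega
          rw [cR _ (by omega), this]
          have := g0 (d - dL - 1) (by omega) (by omega)
          omega
      · rw [cR d (by omega), cR (d + 1) (by omega)]; exact hC2.1 d hd0 hdl
  · rw [cL 0 h0]; exact hC1.2.1
  · rw [cR _ hl]; exact hC2.2.2
  · intro s d hs
    have hsd := P.hE s d hs
    rcases hE s d hs with ⟨hd, hne, u1, u2⟩ | ⟨hd, hne, u1, u2⟩ | ⟨rfl, hd1, hd2⟩
    · obtain ⟨y, x, v1, v2, v3, v4, v5⟩ := hE1 s d hs hne
      refine ⟨y, x, by omega, by omega, by rw [cL d hd]; exact v3, ?_, v5⟩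
      by_cases hd' : d < dL
      · rw [cL _ (by omega)]; exact v4
      · have hd' : d = dL := by omega
        subst hd'
        have := m1 (d + 1) (e2 + 1) (by omega) (by omega) (by omega)
        by_cases hx : d + 1 < dR
        · rw [cM _ (by omega) hx, show d + 1 - d - 1 = 0 by ring]; omega
        · have : d + 1 = dR := by omega
          rw [cR _ (by omega), this]; omega
    · obtain ⟨y, x, v1, v2, v3, v4, v5⟩ := hE2 s d hs hne
      refine ⟨y, x, by omega, by omega, ?_, by rw [cR _ hd]; exact v4, v5⟩
      by_cases hd' : dR ≤ d
      · rw [cR _ hd']; exact v3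
      · have hd' : d + 1 = dR := by omega
        have := m2 e2 d (by omega) (by omega) (by omega)
        by_cases hx : d ≤ dL
        · have : d = e2 := by omega
          have : d = dL := by omega
          subst this
          rw [cL _ le_rfl]
          have := g0 (P.l - 1) (by omega) (by omega)
          omega
        · rw [cM _ (by omega) (by omega)]
          have := gm (d - dL - 1) (P.l - 1) (by omega) (by omega) (by omega)
          omega
    · by_cases hx : d + 1 < dR
      · refine ⟨ρ, G (d - dL), hρ, hρ', ?_, ?_, (g0 _ (by omega) (by omega)).1⟩
        · by_cases hd : d = dL
          · subst hd; rw [cL _ le_rfl]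
            have := g0 (d - d) (by omega) (by omega)
            omega
          · rw [cM _ (by omega) (by omega)]
            have := g1 (d - dL - 1) (by omega) (by omega)
            rw [show d - dL - 1 + 1 = d - dL by ring] at this
            omega
        · rw [cM _ (by omega) hx, show d + 1 - dL - 1 = d - dL by ring]; omega
      · have hx : d + 1 = dR := by omega
        have k1 := g0 (d - dL) (by omega) (by omega)
        refine ⟨ρ, G (d - dL), hρ, hρ', ?_, ?_, k1.1⟩
        · by_cases hd : d = dL
          · subst hd; rw [cL _ le_rfl]
            omega
          · rw [cM _ (by omega) (by omega)]
            have := g1 (d - dL - 1) (by omega) (by omega)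
            rw [show d - dL - 1 + 1 = d - dL by ring] at this
            omega
        · rw [cR _ (by omega), hx]; omega

theorem Conf.pair {P : Pat} {N e1 e2 : ℤ} (h : Conf N P e1 e2) (hN : P.l + 1 ≤ N) :
    ∃ t b l r S ρ f1 f2 R1 C1 R2 C2 G, ¬ Cont P t b l r S ∧
      Pair P e1 e2 t b l r S ρ f1 f2 R1 C1 R2 C2 G := by
  obtain ⟨he, t, b, l, r, S, ρ, f, g, hc, hg, hf⟩ := h
  have hl := P.hE _ _ he
  obtain ⟨_, _, R1, C1, n1⟩ := hf 0 le_rfl (by omega)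
  obtain ⟨_, _, R2, C2, n2⟩ := hf P.l (by omega) (by omega)
  have hm := mono_aux g N (fun s x y => by have := hf s x y; omega)
  refine ⟨t, b, l, r, S, ρ, f 0, f P.l, R1, C1, R2, C2, fun i => g (i + 1), hc, he, n1, n2, ?_, ?_⟩
  · intro i h0 hi
    refine ⟨hg _ (by omega) (by omega), ?_, ?_⟩
    · have := (hf 0 le_rfl (by omega)).2.1
      have := hm (0 + 1) (i + 1) (by omega) (by omega) (by omega)
      show f 0 < g (i + 1)
      omega
    · have := (hf P.l (by omega) (by omega)).1
      have := hm (i + 1) P.l (by omega) (by omega) (by omega)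
      show g (i + 1) < f P.l
      omega
  · intro i h0 hi
    have := hf (i + 1) (by omega) (by omega)
    show g (i + 1) < g (i + 1 + 1)
    omega

theorem minCol (P : Pat) (e1 e2 : ℤ) (h : P.E e1 e2) :
    ∃ dL, P.E e1 dL ∧ ∀ d, P.E e1 d → dL ≤ d := by
  obtain ⟨lb, h1, h2⟩ := Int.exists_least_of_bdd (P := fun d => P.E e1 d)
    ⟨0, fun z hz => (P.hE _ _ hz).2.2.1⟩ ⟨e2, h⟩
  exact ⟨lb, h1, h2⟩

theorem maxCol (P : Pat) (e1 e2 : ℤ) (h : P.E e1 e2) :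
    ∃ dR, P.E e1 dR ∧ ∀ d, P.E e1 d → d ≤ dR := by
  obtain ⟨lb, h1, h2⟩ := Int.exists_greatest_of_bdd (P := fun d => P.E e1 d)
    ⟨P.l, fun z hz => by have := P.hE _ _ hz; omega⟩ ⟨e2, h⟩
  exact ⟨lb, h1, h2⟩

end IMP
namespace IMP

theorem Cuts.min {k t b : ℤ} {A B : ℤ → ℤ} (hA : Cuts k t b A) (hB : Cuts k t b B) :
    Cuts k t b (fun s => min (A s) (B s)) := by
  refine ⟨fun s h0 h1 => ?_, ?_, ?_⟩
  · have := hA.1 s h0 h1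
    have := hB.1 s h0 h1
    show Min.min (A s) (B s) < Min.min (A (s+1)) (B (s+1))
    omega
  · have := hA.2.1
    have := hB.2.1
    show t ≤ Min.min (A 0) (B 0)
    omega
  · have := hA.2.2
    have := hB.2.2
    show Min.min (A k) (B k) ≤ b
    omega

theorem Cuts.max {k t b : ℤ} {A B : ℤ → ℤ} (hA : Cuts k t b A) (hB : Cuts k t b B) :
    Cuts k t b (fun s => max (A s) (B s)) := by
  refine ⟨fun s h0 h1 => ?_, ?_, ?_⟩
  · have := hA.1 s h0 h1
    have := hB.1 s h0 h1
    show Max.max (A s) (B s) < Max.max (A (s+1)) (B (s+1))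
    omega
  · have := hA.2.1
    have := hB.2.1
    show t ≤ Max.max (A 0) (B 0)
    omega
  · have := hA.2.2
    have := hB.2.2
    show Max.max (A k) (B k) ≤ b
    omega

def spl (a : ℤ) (A B : ℤ → ℤ) : ℤ → ℤ := fun s => if s ≤ a then A s else B s

theorem spl_le {a : ℤ} {A B : ℤ → ℤ} {s : ℤ} (h : s ≤ a) : spl a A B s = A s := by
  simp [spl, h]

theorem spl_gt {a : ℤ} {A B : ℤ → ℤ} {s : ℤ} (h : a < s) : spl a A B s = B s := by
  simp [spl, not_le.mpr h]

theorem Cuts.spl {k t b : ℤ} {A B : ℤ → ℤ} (hA : Cuts k t b A) (hB : Cuts k t b B) (a : ℤ)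
    (h0 : 0 ≤ a) (hk : a < k) (h : A a < B (a + 1)) : Cuts k t b (spl a A B) := by
  refine ⟨fun s hs0 hs1 => ?_, ?_, ?_⟩
  · rcases lt_trichotomy s a with hs | rfl | hs
    · rw [spl_le (by omega), spl_le (by omega)]; exact hA.1 s hs0 hs1
    · rw [spl_le (by omega), spl_gt (by omega)]; exact h
    · rw [spl_gt (by omega), spl_gt (by omega)]; exact hB.1 s hs0 hs1
  · rw [spl_le h0]; exact hA.2.1
  · rw [spl_gt hk]; exact hB.2.2

section
variable {P : Pat} {e1 e2 t b l r : ℤ} {S : ℤ → ℤ → Prop} {ρ f1 f2 : ℤ}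
    {R1 C1 R2 C2 G : ℤ → ℤ}

theorem Pair.right (h : Pair P e1 e2 t b l r S ρ f1 f2 R1 C1 R2 C2 G)
    (hq : ∀ s d, P.E s d → e2 < d → s = e1) : Cont P t b l r S := by
  have he := P.hE _ _ h.he
  refine h.mix R1 e2 P.l (by omega) le_rfl (by omega) le_rfl h.n1.1 h.n1.2.2.2.1 h.n1.2.2.2.2.1 ?_
  intro s d hs
  have := P.hE _ _ hs
  have := hq s d hs
  omega

theorem Pair.left (h : Pair P e1 e2 t b l r S ρ f1 f2 R1 C1 R2 C2 G)
    (hq : ∀ s d, P.E s d → d < e2 → s = e1) : Cont P t b l r S := by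
  have he := P.hE _ _ h.he
  refine h.mix R2 0 (e2 + 1) (by omega) (by omega) (by omega) (by omega) h.n2.1 h.n2.2.2.2.1
    h.n2.2.2.2.2.1 ?_
  intro s d hs
  have := P.hE _ _ hs
  have := hq s d hs
  omega

theorem Pair.caseA (h : Pair P e1 e2 t b l r S ρ f1 f2 R1 C1 R2 C2 G) (hq : QF P)
    (hNE : ∀ s d, P.E s d → s < e1 → d ≤ e2) (hSW : ∀ s d, P.E s d → e1 < s → e2 ≤ d)
    {s0 d0 s1 d1 : ℤ} (h0 : P.E s0 d0) (hs0 : s0 < e1) (hd0 : d0 < e2)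
    (h1 : P.E s1 d1) (hs1 : e1 < s1) (hd1 : e2 < d1) : Cont P t b l r S := by
  have he := P.hE _ _ h.he
  obtain ⟨cW, hW, hW'⟩ := minCol P e1 e2 h.he
  obtain ⟨cE, hE, hE'⟩ := maxCol P e1 e2 h.he
  have w1 := hW' _ h.he
  have w2 := hE' _ h.he
  have := P.hE _ _ hW
  have := P.hE _ _ hE
  have a1 := h.n1.2.2.2.1
  have a2 := h.n1.2.2.2.2.1
  have b1 := h.n2.2.2.2.1
  have b2 := h.n2.2.2.2.2.1
  refine h.mix (spl e1 R1 R2) cW (cE + 1) (by omega) (by omega) (by omega) (by omega)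
    (h.n1.1.spl h.n2.1 e1 (by omega) (by omega) (by omega)) (by rw [spl_le le_rfl]; omega)
    (by rw [spl_gt (by omega)]; omega) ?_
  intro s d hs
  rcases lt_trichotomy s e1 with hse | rfl | hse
  · left
    rw [spl_le (by omega), spl_le (by omega)]
    have u := hNE s d hs hse
    have := hq _ _ _ _ _ _ hs hW h1 hse hs1
    omega
  · have := hW' _ hs
    have := hE' _ hs
    omega
  · right; left
    rw [spl_gt (by omega), spl_gt (by omega)]
    have u := hSW s d hs hse
    have := hq _ _ _ _ _ _ h0 hE hs hs0 hse
    omega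

theorem Pair.caseB1 (h : Pair P e1 e2 t b l r S ρ f1 f2 R1 C1 R2 C2 G) (r0 : ℤ) (h0 : 0 ≤ r0)
    (hr0 : r0 < e1) (hx : ∀ s d, P.E s d → d ≠ e2 → s = r0) : Cont P t b l r S := by
  have he := P.hE _ _ h.he
  have a1 := h.n1.2.2.2.1
  have a2 := h.n1.2.2.2.2.1
  have b1 := h.n2.2.2.2.1
  have b2 := h.n2.2.2.2.2.1
  have c1 := h.n1.1.1 r0 h0 (by omega)
  have c2 := h.n2.1.1 r0 h0 (by omega)
  refine h.mix (spl r0 (fun s => min (R1 s) (R2 s)) (fun s => max (R1 s) (R2 s))) e2 (e2 + 1)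
    (by omega) (by omega) (by omega) (by omega)
    ((h.n1.1.min h.n2.1).spl (h.n1.1.max h.n2.1) r0 (by omega) (by omega) (by omega))
    (by rw [spl_gt (by omega)]; omega)
    (by rw [spl_gt (by omega)]; omega) ?_
  intro s d hs
  have := hx s d hs
  rcases lt_trichotomy s r0 with hse | rfl | hse
  · rw [spl_le (by omega), spl_le (by omega)]; omega
  · rw [spl_le (by omega), spl_gt (by omega)]; omega
  · rw [spl_gt (by omega), spl_gt (by omega)]; omega

theorem Pair.caseL1 (h : Pair P e1 e2 t b l r S ρ f1 f2 R1 C1 R2 C2 G) (r0 : ℤ) (h0 : 0 ≤ r0)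
    (hr0 : r0 < e1) (hR : R2 (r0 + 1) ≤ R1 (r0 + 1)) (hx : ∀ s d, P.E s d → r0 ≤ s)
    (hy : ∀ s d, P.E s d → e2 < d → s = e1 ∨ s = r0)
    (hz : ∀ d d', P.E r0 d → P.E e1 d' → e2 < d → e2 < d' → d' ≤ d) : Cont P t b l r S := by
  have he := P.hE _ _ h.he
  obtain ⟨cE, hE, hE'⟩ := maxCol P e1 e2 h.he
  have w2 := hE' _ h.he
  have := P.hE _ _ hE
  have a1 := h.n1.2.2.2.1
  have a2 := h.n1.2.2.2.2.1
  have c1 := h.n1.1.1 r0 h0 (by omega)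
  have c2 := h.n2.1.1 r0 h0 (by omega)
  refine h.mix (spl r0 (fun s => min (R1 s) (R2 s)) R1) e2 (cE + 1)
    (by omega) (by omega) (by omega) (by omega)
    ((h.n1.1.min h.n2.1).spl h.n1.1 r0 (by omega) (by omega) (by omega))
    (by rw [spl_gt (by omega)]; omega)
    (by rw [spl_gt (by omega)]; omega) ?_
  intro s d hs
  have k1 := hx s d hs
  have k2 := hy s d hs
  rcases k1.lt_or_eq with hse | rfl
  · rw [spl_gt (by omega), spl_gt (by omega)]
    by_cases hse : s = e1
    · subst hse
      have := hE' _ hs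
      omega
    · omega
  · rw [spl_le (by omega), spl_gt (by omega)]
    have := hz d cE hs hE
    omega

theorem Pair.caseL2 (h : Pair P e1 e2 t b l r S ρ f1 f2 R1 C1 R2 C2 G) (r0 : ℤ) (h0 : 0 ≤ r0)
    (hr0 : r0 < e1) (hR : R1 (r0 + 1) ≤ R2 (r0 + 1)) (hx : ∀ s d, P.E s d → r0 ≤ s)
    (hy : ∀ s d, P.E s d → d < e2 → s = e1 ∨ s = r0)
    (hz : ∀ d d', P.E r0 d → P.E e1 d' → d < e2 → d' < e2 → d ≤ d') : Cont P t b l r S := by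
  have he := P.hE _ _ h.he
  obtain ⟨cE, hE, hE'⟩ := minCol P e1 e2 h.he
  have w2 := hE' _ h.he
  have := P.hE _ _ hE
  have a1 := h.n2.2.2.2.1
  have a2 := h.n2.2.2.2.2.1
  have c1 := h.n1.1.1 r0 h0 (by omega)
  have c2 := h.n2.1.1 r0 h0 (by omega)
  refine h.mix (spl r0 (fun s => min (R1 s) (R2 s)) R2) cE (e2 + 1)
    (by omega) (by omega) (by omega) (by omega)
    ((h.n1.1.min h.n2.1).spl h.n2.1 r0 (by omega) (by omega) (by omega))
    (by rw [spl_gt (by omega)]; omega)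
    (by rw [spl_gt (by omega)]; omega) ?_
  intro s d hs
  have k1 := hx s d hs
  have k2 := hy s d hs
  rcases k1.lt_or_eq with hse | rfl
  · rw [spl_gt (by omega), spl_gt (by omega)]
    by_cases hse : s = e1
    · subst hse
      have := hE' _ hs
      omega
    · omega
  · rw [spl_le (by omega), spl_gt (by omega)]
    have := hz d cE hs hE
    omega

theorem Pair.caseD (h : Pair P e1 e2 t b l r S ρ f1 f2 R1 C1 R2 C2 G) (hq : QF P)
    (hSE : ∀ s d, P.E s d → e1 < s → d ≤ e2)
    {s0 d0 s1 d1 s2 d2 : ℤ} (h0 : P.E s0 d0) (hs0 : s0 < e1) (hd0 : d0 < e2)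
    (h1 : P.E s1 d1) (hs1 : s1 < e1) (hd1 : e2 < d1)
    (h2 : P.E s2 d2) (hs2 : e1 < s2) (hd2 : d2 < e2) : Cont P t b l r S := by
  have he := P.hE _ _ h.he
  have hNE : ∀ s d, P.E s d → s < e1 → e2 < d → s = s0 := by
    intro s d hs ha hb
    have := hq _ _ _ _ _ _ hs h0 h.he
    have := hq _ _ _ _ _ _ h0 hs h.he
    omega
  have hs01 := hNE _ _ h1 hs1 hd1
  subst hs01
  have hNW : ∀ s d, P.E s d → s < e1 → d < e2 → s = s1 := by
    intro s d hs ha hb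
    have := hq _ _ _ _ _ _ hs h1 h.he
    have := hq _ _ _ _ _ _ h1 hs h.he
    omega
  have hSW : ∀ s d, P.E s d → e1 < s → d < e2 → d = d0 := by
    intro s d hs ha hb
    have := hq _ _ _ _ _ _ h0 h.he hs
    omega
  have hd02 := hSW _ _ h2 hs2 hd2
  subst hd02
  have hNWc : ∀ s d, P.E s d → s < e1 → d < e2 → d = d2 := by
    intro s d hs ha hb
    have := hq _ _ _ _ _ _ hs h.he h2
    omega
  have hN : ∀ s d, P.E s d → s1 ≤ s := by
    intro s d hs
    by_contra hlt
    have := hNE _ _ hs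
    have := hNW _ _ hs
    have := hq _ _ _ _ _ _ hs h1 h2
    omega
  have hW : ∀ d, P.E e1 d → d2 ≤ d := by
    intro d hs
    have := hq _ _ _ _ _ _ h1 hs h2
    omega
  have hEE : ∀ d d', P.E s1 d → P.E e1 d' → e2 < d → e2 < d' → d' ≤ d := by
    intro d d' ha hb hc hd
    have := hq _ _ _ _ _ _ ha hb h2
    omega
  by_cases hR : R2 (s1 + 1) ≤ R1 (s1 + 1)
  · have := P.hE _ _ h1
    refine h.caseL1 s1 (by omega) (by omega) hR hN ?_ hEE
    intro s d hs hd
    have := hNE _ _ hs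
    have := hSE _ _ hs
    omega
  · obtain ⟨cE, hE, hE'⟩ := maxCol P e1 e2 h.he
    obtain ⟨cW, hWm, hWm'⟩ := minCol P e1 e2 h.he
    have w1 := hE' _ h.he
    have w2 := hWm' _ h.he
    have := P.hE _ _ hE
    have := P.hE _ _ hWm
    have := P.hE _ _ h1
    have a1 := h.n1.2.2.2.1
    have a2 := h.n1.2.2.2.2.1
    have b1 := h.n2.2.2.2.1
    have b2 := h.n2.2.2.2.2.1
    have c1 := h.n1.1.1 s1 (by omega) (by omega)
    have c2 := h.n2.1.1 s1 (by omega) (by omega)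
    refine h.mix (spl e1 (spl s1 (fun s => min (R1 s) (R2 s)) R2) R1) cW (cE + 1)
      (by omega) (by omega) (by omega) (by omega)
      (((h.n1.1.min h.n2.1).spl h.n2.1 s1 (by omega) (by omega) (by omega)).spl h.n1.1
        e1 (by omega) (by omega) (by rw [spl_gt (by omega)]; omega))
      (by rw [spl_le (by omega), spl_gt (by omega)]; omega)
      (by rw [spl_gt (by omega)]; omega) ?_
    intro s d hs
    have k0 := hN _ _ hs
    rcases lt_trichotomy s e1 with hse | rfl | hse
    · rw [spl_le (a := e1) (s := s) (by omega), spl_le (a := e1) (s := s + 1) (by omega),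
        spl_gt (a := s1) (s := s + 1) (by omega)]
      have k1 := hNE _ _ hs hse
      have k2 := hNW _ _ hs hse
      have k3 := hNWc _ _ hs hse
      have k4 := hW _ hWm
      have k5 := hq _ _ _ _ _ _ hs hE h2
      rcases k0.lt_or_eq with hse' | rfl
      · rw [spl_gt (a := s1) (by omega)]; omega
      · rw [spl_le (by omega)]
        have := hEE _ _ hs hE
        omega
    · have := hWm' _ hs
      have := hE' _ hs
      omega
    · rw [spl_gt (by omega), spl_gt (by omega)]
      have k1 := hSE _ _ hs hse
      have k2 := hSW _ _ hs hse
      have k4 := hW _ hWm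
      have k5 := hq _ _ _ _ _ _ h1 hWm hs
      omega

theorem Pair.caseE (h : Pair P e1 e2 t b l r S ρ f1 f2 R1 C1 R2 C2 G) (hq : QF P)
    {s0 d0 s1 d1 s2 d2 s3 d3 : ℤ} (h0 : P.E s0 d0) (hs0 : s0 < e1) (hd0 : d0 < e2)
    (h1 : P.E s1 d1) (hs1 : s1 < e1) (hd1 : e2 < d1)
    (h2 : P.E s2 d2) (hs2 : e1 < s2) (hd2 : d2 < e2)
    (h3 : P.E s3 d3) (hs3 : e1 < s3) (hd3 : e2 < d3) : Cont P t b l r S := by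
  have he := P.hE _ _ h.he
  have hNE : ∀ s d, P.E s d → s < e1 → e2 < d → s = s0 ∧ d = d3 := by
    intro s d hs ha hb
    have := hq _ _ _ _ _ _ hs h0 h.he
    have := hq _ _ _ _ _ _ h0 hs h.he
    have := hq _ _ _ _ _ _ hs h.he h3
    omega
  obtain ⟨rfl, rfl⟩ := hNE _ _ h1 hs1 hd1
  have hNW : ∀ s d, P.E s d → s < e1 → d < e2 → s = s1 ∧ d = d2 := by
    intro s d hs ha hb
    have := hq _ _ _ _ _ _ hs h1 h.he
    have := hq _ _ _ _ _ _ h1 hs h.he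
    have := hq _ _ _ _ _ _ hs h.he h2
    omega
  obtain ⟨-, rfl⟩ := hNW _ _ h0 hs0 hd0
  have hSW : ∀ s d, P.E s d → e1 < s → d < e2 → s = s3 ∧ d = d0 := by
    intro s d hs ha hb
    have := hq _ _ _ _ _ _ h.he hs h3
    have := hq _ _ _ _ _ _ h.he h3 hs
    have := hq _ _ _ _ _ _ h0 h.he hs
    omega
  obtain ⟨rfl, -⟩ := hSW _ _ h2 hs2 hd2
  have hSE : ∀ s d, P.E s d → e1 < s → e2 < d → s = s2 ∧ d = d1 := by
    intro s d hs ha hb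
    have := hq _ _ _ _ _ _ h.he hs h2
    have := hq _ _ _ _ _ _ h.he h2 hs
    have := hq _ _ _ _ _ _ h1 h.he hs
    omega
  obtain ⟨cE, hE, hE'⟩ := maxCol P e1 e2 h.he
  obtain ⟨cW, hWm, hWm'⟩ := minCol P e1 e2 h.he
  have w1 := hE' _ h.he
  have w2 := hWm' _ h.he
  have := P.hE _ _ hE
  have := P.hE _ _ hWm
  have := P.hE _ _ h1
  have := P.hE _ _ h2
  have a1 := h.n1.2.2.2.1
  have a2 := h.n1.2.2.2.2.1
  have b1 := h.n2.2.2.2.1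
  have b2 := h.n2.2.2.2.2.1
  have c1 := h.n1.1.1 s1 (by omega) (by omega)
  have c2 := h.n2.1.1 s1 (by omega) (by omega)
  have c3 := h.n1.1.1 s2 (by omega) (by omega)
  have c4 := h.n2.1.1 s2 (by omega) (by omega)
  have x1 : d0 ≤ cW := by
    have := hq _ _ _ _ _ _ h1 hWm h2
    omega
  have x2 : cE ≤ d1 := by
    have := hq _ _ _ _ _ _ h0 hE h3
    have := hq _ _ _ _ _ _ h1 hE h2
    omega
  have hmin := h.n1.1.min h.n2.1
  have hmax := h.n1.1.max h.n2.1
  have hA := hmin.spl hmax s1 (by omega) (by omega) (by omega)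
  have hB := hmin.spl hmax s2 (by omega) (by omega) (by omega)
  refine h.mix _ cW (cE + 1)
    (by omega) (by omega) (by omega) (by omega)
    (hA.spl hB e1 (by omega) (by omega)
      (by rw [spl_gt (by omega), spl_le (by omega)]; omega))
    (by rw [spl_le (by omega), spl_gt (by omega)]; omega)
    (by rw [spl_gt (by omega), spl_le (by omega)]; omega) ?_
  intro s d hs
  rcases lt_trichotomy s e1 with hse | rfl | hse
  · rw [spl_le (a := e1) (s := s) (by omega), spl_le (a := e1) (s := s + 1) (by omega)]
    have k1 := hNE _ _ hs hse
    have k2 := hNW _ _ hs hse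
    have k3 := hq _ _ _ _ _ _ hs h1 h2
    have k4 := hq _ _ _ _ _ _ hs hWm h3
    have k5 := hq _ _ _ _ _ _ hs hE h2
    rcases lt_trichotomy s s1 with hse' | rfl | hse'
    · omega
    · rw [spl_le (a := s) (s := s) (by omega), spl_gt (a := s) (s := s + 1) (by omega)]; omega
    · rw [spl_gt (a := s1) (s := s) (by omega), spl_gt (a := s1) (s := s + 1) (by omega)]; omega
  · have := hWm' _ hs
    have := hE' _ hs
    omega
  · rw [spl_gt (a := e1) (s := s) (by omega), spl_gt (a := e1) (s := s + 1) (by omega)]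
    have k1 := hSE _ _ hs hse
    have k2 := hSW _ _ hs hse
    have k3 := hq _ _ _ _ _ _ h1 h2 hs
    have k4 := hq _ _ _ _ _ _ h1 hWm hs
    have k5 := hq _ _ _ _ _ _ h0 hE hs
    rcases lt_trichotomy s s2 with hse' | rfl | hse'
    · rw [spl_le (a := s2) (s := s) (by omega), spl_le (a := s2) (s := s + 1) (by omega)]; omega
    · rw [spl_le (a := s) (s := s) (by omega), spl_gt (a := s) (s := s + 1) (by omega)]; omega
    · omega

end
end IMP
namespace IMP

theorem Conf.caseB3 {P : Pat} {N e1 e2 : ℤ} (h : Conf N P e1 e2) (hN : P.l * P.l + 1 ≤ N)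
    (r0 dx dz : ℤ) (hr0 : r0 < e1) (hx : P.E r0 dx) (hdx : dx < e2) (hz : P.E r0 dz)
    (hdz : e2 < dz) (hrow : ∀ s d, P.E s d → s = r0 ∨ s = e1) : False := by
  obtain ⟨he, t, b, l, r, S, ρ, f, g, hc, hg, hf⟩ := h
  apply hc
  have pe := P.hE _ _ he
  have px := P.hE _ _ hx
  have pz := P.hE _ _ hz
  have hNl : P.l ≤ P.l * P.l := by nlinarith
  have gm := mono_aux g N (fun s x y => by have := hf s x y; omega)
  have gf : ∀ i j, 0 ≤ i → i ≤ j → j < N → g i < f j := by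
    intro i j h0 hij hj
    have := gm i j h0 hij (by omega)
    have := hf j (by omega) hj
    omega
  have fg : ∀ i j, 0 ≤ i → i < j → j ≤ N → f i < g j := by
    intro i j h0 hij hj
    have := gm (i + 1) j (by omega) (by omega) (by omega)
    have := hf i (by omega) (by omega)
    omega
  have ff : ∀ i j, 0 ≤ i → i < j → j < N → f i < f j := by
    intro i j h0 hij hj
    have := gf j j (by omega) le_rfl hj
    have := fg i j h0 hij (by omega)
    omega
  -- maximal row cut
  obtain ⟨ub, ⟨i0, R0, C0, hi0, hi0', hn0, hub⟩, hmax⟩ := Int.exists_greatest_of_bdd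
    (P := fun z => ∃ i R C, 0 ≤ i ∧ i < N ∧ Near P t b l r S e1 e2 ρ (f i) R C ∧ R (r0 + 1) = z)
    ⟨b, by
      rintro z ⟨i, R, C, h1, h2, hn, rfl⟩
      have := hn.1.hi (r0 + 1) (by omega) (by omega)
      omega⟩
    (by
      obtain ⟨_, _, R, C, hn⟩ := hf 0 le_rfl (by omega)
      exact ⟨_, 0, R, C, le_rfl, by omega, hn, rfl⟩)
  have hT : ∀ i R C, 0 ≤ i → i < N → Near P t b l r S e1 e2 ρ (f i) R C → ∀ d, P.E r0 d →
      ∃ x, C d ≤ x ∧ x < C (d + 1) ∧ ∃ y, t + r0 ≤ y ∧ y < ub ∧ S y x := by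
    intro i R C h1 h2 hn d hd
    obtain ⟨y, x, a1, a2, a3, a4, a5⟩ := hn.2.2.1 r0 d hd (by omega)
    have := hmax _ ⟨i, R, C, h1, h2, hn, rfl⟩
    have := hn.1.lo r0 (by omega) (by omega)
    exact ⟨x, a3, a4, y, by omega, by omega, a5⟩
  by_cases hall : ∀ m, 0 ≤ m → m < P.l → ∃ x, f (m * P.l) ≤ x ∧ x < f ((m + 1) * P.l) ∧
      ∃ y, t + r0 ≤ y ∧ y < ub ∧ S y x
  · -- all blocks contain a good column
    have hbd : ∀ m, 0 ≤ m → m ≤ P.l → 0 ≤ m * P.l ∧ m * P.l < N := by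
      intro m h1 h2
      constructor
      · nlinarith
      · nlinarith
    have lo := hn0.1.lo (r0 + 1) (by omega) (by omega)
    refine ⟨spl r0 (fun s => t + s) R0, fun m => f (m * P.l), ⟨?_, ?_, ?_⟩, ⟨?_, ?_, ?_⟩, ?_⟩
    · intro s h1 h2
      rcases lt_trichotomy s r0 with hs | rfl | hs
      · rw [spl_le (by omega), spl_le (by omega)]; omega
      · rw [spl_le (by omega), spl_gt (by omega)]; omega
      · rw [spl_gt (by omega), spl_gt (by omega)]; exact hn0.1.1 s h1 h2
    · rw [spl_le (by omega)]; omega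
    · rw [spl_gt (by omega)]; exact hn0.1.2.2
    · intro m h1 h2
      have := hbd m h1 (by omega)
      have := hbd (m + 1) (by omega) (by omega)
      apply ff _ _ (by omega) _ (by omega)
      nlinarith
    · show l ≤ f (0 * P.l)
      rw [zero_mul]
      obtain ⟨_, _, R, C, hn⟩ := hf 0 le_rfl (by omega)
      have := hn.2.1.lo e2 (by omega) (by omega)
      have := hn.2.2.2.2.2.1
      omega
    · show f (P.l * P.l) ≤ r
      obtain ⟨_, _, R, C, hn⟩ := hf (P.l * P.l) (by omega) (by omega)
      have := hn.2.1.hi (e2 + 1) (by omega) (by omega)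
      have := hn.2.2.2.2.2.2
      omega
    · intro s d hs
      have ps := P.hE _ _ hs
      rcases hrow s d hs with rfl | rfl
      · obtain ⟨x, a1, a2, y, a3, a4, a5⟩ := hall d (by omega) (by omega)
        refine ⟨y, x, ?_, ?_, a1, a2, a5⟩
        · rw [spl_le (by omega)]; exact a3
        · rw [spl_gt (by omega)]; omega
      · have b1 := hbd d (by omega) (by omega)
        have b2 := hbd (d + 1) (by omega) (by omega)
        have b3 : d * P.l + 1 ≤ (d + 1) * P.l := by nlinarith
        refine ⟨ρ, g (d * P.l + 1), ?_, ?_, ?_, ?_, hg _ (by omega) (by omega)⟩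
        · rw [spl_gt (by omega)]; exact hn0.2.2.2.1
        · rw [spl_gt (by omega)]; exact hn0.2.2.2.2.1
        · have := fg (d * P.l) (d * P.l + 1) (by omega) (by omega) (by omega)
          show f (d * P.l) ≤ _
          omega
        · exact gf _ _ (by omega) (by omega) (by omega)
  · push Not at hall
    obtain ⟨m, hm0, hm1, hno⟩ := hall
    have j1 : 0 ≤ m * P.l := by nlinarith
    have j2 : (m + 1) * P.l = m * P.l + P.l := by ring
    have j3 : m * P.l + P.l < N := by nlinarith
    rw [j2] at hno
    generalize m * P.l = j at *
    obtain ⟨_, _, R, C, hn⟩ := hf (j + 1) (by omega) (by omega)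
    have z1 := fg j (j + 1) (by omega) (by omega) (by omega)
    have z2 := fg (j + 1) (j + 2) (by omega) (by omega) (by omega)
    have z3 := gf (j + 1) (j + 1) (by omega) (by omega) (by omega)
    have z4 := gf (j + 2) (j + P.l) (by omega) (by omega) (by omega)
    have n1 := hn.2.2.2.2.2.1
    have n2 := hn.2.2.2.2.2.2
    by_cases q1 : C e2 ≤ g (j + 1)
    · exact hn.close (hg (j + 1) (by omega) (by omega)) q1 (by omega)
    by_cases q2 : g (j + 2) < C (e2 + 1)
    · exact hn.close (hg (j + 2) (by omega) (by omega)) (by omega) q2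
    have hT' : ∀ d, P.E r0 d → ∃ x y, R r0 ≤ y ∧ y < R (r0 + 1) ∧ C d ≤ x ∧ x < C (d + 1) ∧ S y x ∧
        (x < f j ∨ f (j + P.l) ≤ x) := by
      intro d hd
      obtain ⟨y, x, a1, a2, a3, a4, a5⟩ := hn.2.2.1 r0 d hd (by omega)
      have := hmax _ ⟨j + 1, R, C, by omega, by omega, hn, rfl⟩
      have := hn.1.lo r0 (by omega) (by omega)
      refine ⟨x, y, a1, a2, a3, a4, a5, ?_⟩
      by_contra hcon
      exact hno x (by omega) (by omega) y (by omega) (by omega) a5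
    have hr0c : ¬ P.E r0 e2 := by
      intro hd
      obtain ⟨x, y, a1, a2, a3, a4, a5, a6⟩ := hT' _ hd
      omega
    obtain ⟨cX, ⟨hX, hX1⟩, hX2⟩ := Int.exists_greatest_of_bdd (P := fun d => P.E r0 d ∧ d < e2)
      ⟨e2, fun z hz => by omega⟩ ⟨dx, hx, hdx⟩
    obtain ⟨cY, ⟨hY, hY1⟩, hY2⟩ := Int.exists_least_of_bdd (P := fun d => P.E r0 d ∧ e2 < d)
      ⟨e2, fun z hz => by omega⟩ ⟨dz, hz, hdz⟩
    have pX := P.hE _ _ hX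
    have pY := P.hE _ _ hY
    obtain ⟨x1, y1, a1, a2, a3, a4, a5, a6⟩ := hT' _ hX
    obtain ⟨x2, y2, b1, b2, b3, b4, b5, b6⟩ := hT' _ hY
    have cm := hn.2.1.mono
    have cm1 := cm (cX + 1) e2 (by omega) (by omega) (by omega)
    have cm2 := cm (e2 + 1) cY (by omega) (by omega) (by omega)
    have a6 : x1 < f j := by
      have := ff j (j + P.l) (by omega) (by omega) (by omega)
      have := ff (j + 1) (j + P.l) (by omega) (by omega) (by omega)
      omega
    have b6 : f (j + P.l) ≤ x2 := by omega
    have G : ∀ i, 0 ≤ i → i ≤ cY - cX → f j < g (j + 1 + i) ∧ g (j + 1 + i) < f (j + P.l) ∧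
        S ρ (g (j + 1 + i)) := by
      intro i h0 h1
      exact ⟨fg _ _ (by omega) (by omega) (by omega), gf _ _ (by omega) (by omega) (by omega),
        hg _ (by omega) (by omega)⟩
    have G1 : ∀ i, 0 ≤ i → i ≤ cY - cX → g (j + 1 + (i - 1)) < g (j + 1 + i) := by
      intro i h0 h1
      have := gm (j + 1 + (i - 1)) (j + 1 + i) (by omega) (by omega) (by omega)
      omega
    set D : ℤ → ℤ := spl cX C (spl cY (fun d => g (j + 1 + (d - cX - 1)) + 1) C) with hD
    have d1 : ∀ d, d ≤ cX → D d = C d := fun d hd => by rw [hD, spl_le hd]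
    have d2 : ∀ d, cX < d → d ≤ cY → D d = g (j + 1 + (d - cX - 1)) + 1 := fun d hd hd' => by
      rw [hD, spl_gt hd, spl_le hd']
    have d3 : ∀ d, cY < d → D d = C d := fun d hd => by
      rw [hD, spl_gt (by omega), spl_gt hd]
    have G0 := G 0 le_rfl (by omega)
    have d4 : D (cX + 1) = g (j + 1 + 0) + 1 := by
      rw [d2 _ (by omega) (by omega), show cX + 1 - cX - 1 = 0 by ring]
    refine ⟨R, D, hn.1, ⟨?_, ?_, ?_⟩, ?_⟩
    · intro d h0 h1
      rcases lt_trichotomy d cX with hd | rfl | hd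
      · rw [d1 d (by omega), d1 (d + 1) (by omega)]; exact hn.2.1.1 d h0 h1
      · rw [d1 d le_rfl, d4]; omega
      · rcases lt_trichotomy d cY with hd' | rfl | hd'
        · rw [d2 d hd (by omega), d2 (d + 1) (by omega) (by omega)]
          have := G1 (d - cX) (by omega) (by omega)
          rw [show d + 1 - cX - 1 = d - cX by ring]
          rw [show d - cX - 1 = (d - cX) - 1 by ring]
          omega
        · rw [d2 d hd le_rfl, d3 _ (by omega)]
          have := G (d - cX - 1) (by omega) (by omega)
          omega
        · rw [d3 d (by omega), d3 (d + 1) (by omega)]; exact hn.2.1.1 d h0 h1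
    · rw [d1 _ (by omega)]; exact hn.2.1.2.1
    · rw [d3 _ (by omega)]; exact hn.2.1.2.2
    · intro s d hs
      have ps := P.hE _ _ hs
      by_cases hd1 : d < cX
      · obtain ⟨y, x, u1, u2, u3, u4, u5⟩ := hn.2.2.1 s d hs (by omega)
        exact ⟨y, x, u1, u2, by rw [d1 _ (by omega)]; exact u3, by rw [d1 _ (by omega)]; exact u4, u5⟩
      by_cases hd2 : cY < d
      · obtain ⟨y, x, u1, u2, u3, u4, u5⟩ := hn.2.2.1 s d hs (by omega)
        exact ⟨y, x, u1, u2, by rw [d3 _ (by omega)]; exact u3, by rw [d3 _ (by omega)]; exact u4, u5⟩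
      rcases hrow s d hs with rfl | rfl
      · have k1 := hX2 d
        have k2 := hY2 d
        have k3 : d ≠ e2 := by rintro rfl; exact hr0c hs
        have : d = cX ∨ d = cY := by
          rcases lt_or_gt_of_ne k3 with k | k
          · have := k1 ⟨hs, k⟩; omega
          · have := k2 ⟨hs, k⟩; omega
        rcases this with rfl | rfl
        · refine ⟨y1, x1, a1, a2, by rw [d1 _ le_rfl]; exact a3, by rw [d4]; omega, a5⟩
        · refine ⟨y2, x2, b1, b2, ?_, by rw [d3 _ (by omega)]; exact b4, b5⟩
          rw [d2 _ (by omega) le_rfl]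
          have := G (d - cX - 1) (by omega) (by omega)
          omega
      · have Gd := G (d - cX) (by omega) (by omega)
        refine ⟨ρ, g (j + 1 + (d - cX)), hn.2.2.2.1, hn.2.2.2.2.1, ?_, ?_, Gd.2.2⟩
        · by_cases hdd : d = cX
          · subst hdd
            rw [d1 _ le_rfl]
            omega
          · rw [d2 _ (by omega) (by omega)]
            have := G1 (d - cX) (by omega) (by omega)
            omega
        · by_cases hdd : d = cY
          · subst hdd
            rw [d3 _ (by omega)]
            omega
          · rw [d2 _ (by omega) (by omega), show d + 1 - cX - 1 = d - cX by ring]; omega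

theorem Conf.caseB {P : Pat} {N e1 e2 : ℤ} (h : Conf N P e1 e2) (hN : P.l * P.l + P.l + 2 ≤ N)
    (hq : QF P) (hS : ∀ s d, P.E s d → e1 < s → d = e2)
    {s0 d0 s1 d1 : ℤ} (h0 : P.E s0 d0) (hs0 : s0 < e1) (hd0 : d0 < e2)
    (h1 : P.E s1 d1) (hs1 : s1 < e1) (hd1 : e2 < d1) : False := by
  have he := h.1
  have pe := P.hE _ _ he
  have p0 := P.hE _ _ h0
  have hNE : ∀ s d, P.E s d → s < e1 → e2 < d → s = s0 := by
    intro s d hs ha hb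
    have := hq _ _ _ _ _ _ hs h0 he
    have := hq _ _ _ _ _ _ h0 hs he
    omega
  have hs01 := hNE _ _ h1 hs1 hd1
  subst hs01
  have hNW : ∀ s d, P.E s d → s < e1 → d < e2 → s = s1 := by
    intro s d hs ha hb
    have := hq _ _ _ _ _ _ hs h1 he
    have := hq _ _ _ _ _ _ h1 hs he
    omega
  have hll : 0 ≤ P.l * P.l := by nlinarith
  obtain ⟨t, b, l, r, S, ρ, f1, f2, R1, C1, R2, C2, G, hc, hp⟩ := h.pair (by omega)
  by_cases hwe : ∀ d, P.E e1 d → d = e2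
  · apply hc
    refine hp.caseB1 s1 (by omega) hs1 ?_
    intro s d hs hd
    have k1 := hNE _ _ hs
    have k2 := hNW _ _ hs
    have k3 := hS _ _ hs
    rcases lt_trichotomy s e1 with k | rfl | k
    · omega
    · exact absurd (hwe _ hs) hd
    · omega
  push Not at hwe
  obtain ⟨d', hd', hne⟩ := hwe
  have hN1 : ∀ s d, P.E s d → s1 ≤ s := by
    intro s d hs
    have k1 := hNE _ _ hs
    have k2 := hNW _ _ hs
    have k4 := hq _ _ _ _ _ _ hs h1 hd'
    have k5 := hq _ _ _ _ _ _ hs h0 hd'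
    omega
  by_cases hB3 : ∀ s d, P.E s d → s = s1 ∨ s = e1
  · exact h.caseB3 (by omega) s1 d0 d1 hs1 h0 hd0 h1 hd1 hB3
  push Not at hB3
  obtain ⟨su, du, hu, hu1, hu2⟩ := hB3
  have k0 := hN1 _ _ hu
  have hdu : du = e2 := by
    have k1 := hNE _ _ hu
    have k2 := hNW _ _ hu
    have k3 := hS _ _ hu
    omega
  subst hdu
  apply hc
  have y1 : ∀ s d, P.E s d → d ≠ du → s = e1 ∨ s = s1 := by
    intro s d hs hd
    have k1 := hNE _ _ hs
    have k2 := hNW _ _ hs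
    have k3 := hS _ _ hs
    omega
  have y2 : ∀ d d', P.E s1 d → P.E e1 d' → (du < d → du < d' → d' ≤ d) ∧ (d < du → d' < du → d ≤ d') := by
    intro d d' ha hb
    have := hq _ _ _ _ _ _ ha hu hb
    have := hq _ _ _ _ _ _ ha hb hu
    omega
  rcases le_total (R2 (s1 + 1)) (R1 (s1 + 1)) with hR | hR
  · exact hp.caseL1 s1 (by omega) hs1 hR hN1 (fun s d hs hd => y1 s d hs (by omega))
      (fun d d' ha hb hc hd => (y2 d d' ha hb).1 hc hd)
  · exact hp.caseL2 s1 (by omega) hs1 hR hN1 (fun s d hs hd => y1 s d hs (by omega))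
      (fun d d' ha hb hc hd => (y2 d d' ha hb).2 hc hd)

theorem not_conf {P : Pat} {N e1 e2 : ℤ} (h : Conf N P e1 e2) (hN : P.l * P.l + P.l + 2 ≤ N)
    (hq : QF P) : False := by
  have he := P.hE _ _ h.1
  have hll : 0 ≤ P.l * P.l := by nlinarith
  have cA : ∀ (P : Pat) (e1 e2 : ℤ), P.l + 1 ≤ N → Conf N P e1 e2 → QF P →
      (∀ s d, P.E s d → s < e1 → d ≤ e2) → (∀ s d, P.E s d → e1 < s → e2 ≤ d) →
      (∃ s0 d0, P.E s0 d0 ∧ s0 < e1 ∧ d0 < e2) → (∃ s1 d1, P.E s1 d1 ∧ e1 < s1 ∧ e2 < d1) →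
      False := by
    rintro P e1 e2 hN h hq a a2 ⟨s0, d0, x1, x2, x3⟩ ⟨s1, d1, y1, y2, y3⟩
    obtain ⟨t, b, l, r, S, ρ, f1, f2, R1, C1, R2, C2, G, hc, hp⟩ := h.pair (by omega)
    exact hc (hp.caseA hq a a2 x1 x2 x3 y1 y2 y3)
  have cD : ∀ (P : Pat) (e1 e2 : ℤ), P.l + 1 ≤ N → Conf N P e1 e2 → QF P →
      (∀ s d, P.E s d → e1 < s → d ≤ e2) →
      (∃ s0 d0, P.E s0 d0 ∧ s0 < e1 ∧ d0 < e2) → (∃ s1 d1, P.E s1 d1 ∧ s1 < e1 ∧ e2 < d1) →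
      (∃ s1 d1, P.E s1 d1 ∧ e1 < s1 ∧ d1 < e2) →
      False := by
    rintro P e1 e2 hN h hq a ⟨s0, d0, x1, x2, x3⟩ ⟨s1, d1, y1, y2, y3⟩ ⟨s2, d2, z1, z2, z3⟩
    obtain ⟨t, b, l, r, S, ρ, f1, f2, R1, C1, R2, C2, G, hc, hp⟩ := h.pair (by omega)
    exact hc (hp.caseD hq a x1 x2 x3 y1 y2 y3 z1 z2 z3)
  have cDH : ∀ (P : Pat) (e1 e2 : ℤ), P.l + 1 ≤ N → Conf N P e1 e2 → QF P →
      (∀ s d, P.E s d → e1 < s → e2 ≤ d) →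
      (∃ s0 d0, P.E s0 d0 ∧ s0 < e1 ∧ d0 < e2) → (∃ s1 d1, P.E s1 d1 ∧ s1 < e1 ∧ e2 < d1) →
      (∃ s1 d1, P.E s1 d1 ∧ e1 < s1 ∧ e2 < d1) →
      False := by
    rintro P e1 e2 hN h hq a ⟨s0, d0, x1, x2, x3⟩ ⟨s1, d1, y1, y2, y3⟩ ⟨s2, d2, z1, z2, z3⟩
    refine cD P.H e1 (P.l - 1 - e2) hN h.flipH hq.H ?_ ⟨s1, P.l - 1 - d1, ?_, y2, by omega⟩
      ⟨s0, P.l - 1 - d0, ?_, x2, by omega⟩ ⟨s2, P.l - 1 - d2, ?_, z2, by omega⟩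
    · intro s d hs hd
      have := a _ _ hs hd
      omega
    · show P.E s1 (P.l - 1 - (P.l - 1 - d1))
      rw [sub_sub_cancel]; exact y1
    · show P.E s0 (P.l - 1 - (P.l - 1 - d0))
      rw [sub_sub_cancel]; exact x1
    · show P.E s2 (P.l - 1 - (P.l - 1 - d2))
      rw [sub_sub_cancel]; exact z1
  have lift : ∀ s d, P.E s d → P.V.E (P.k - 1 - s) d := by
    intro s d hs
    show P.E (P.k - 1 - (P.k - 1 - s)) d
    rw [sub_sub_cancel]; exact hs
  have hV : ∀ s d, P.V.E s d → P.E (P.k - 1 - s) d := fun s d hs => hs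
  obtain ⟨t, b, l, r, S, ρ, f1, f2, R1, C1, R2, C2, G, hc, hp⟩ := h.pair (by omega)
  by_cases NW : ∃ s d, P.E s d ∧ s < e1 ∧ d < e2 <;>
  by_cases NE : ∃ s d, P.E s d ∧ s < e1 ∧ e2 < d <;>
  by_cases SW : ∃ s d, P.E s d ∧ e1 < s ∧ d < e2 <;>
  by_cases SE : ∃ s d, P.E s d ∧ e1 < s ∧ e2 < d
  · obtain ⟨s0, d0, w1, w2, w3⟩ := NW
    obtain ⟨s1, d1, x1, x2, x3⟩ := NE
    obtain ⟨s2, d2, y1, y2, y3⟩ := SW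
    obtain ⟨s3, d3, z1, z2, z3⟩ := SE
    exact hc (hp.caseE hq w1 w2 w3 x1 x2 x3 y1 y2 y3 z1 z2 z3)
  · push Not at SE
    exact cD P e1 e2 (by omega) h hq SE NW NE SW
  · push Not at SW
    exact cDH P e1 e2 (by omega) h hq SW NW NE SE
  · push Not at SW SE
    obtain ⟨s0, d0, w1, w2, w3⟩ := NW
    obtain ⟨s1, d1, x1, x2, x3⟩ := NE
    refine h.caseB hN hq ?_ w1 w2 w3 x1 x2 x3
    intro s d hs hd
    have := SW _ _ hs hd
    have := SE _ _ hs hd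
    omega
  · -- NE missing
    push Not at NE
    obtain ⟨s0, d0, w1, w2, w3⟩ := NW
    obtain ⟨s2, d2, y1, y2, y3⟩ := SW
    obtain ⟨s3, d3, z1, z2, z3⟩ := SE
    refine cD P.V (P.k - 1 - e1) e2 (by show P.l + 1 ≤ N; omega) h.flipV hq.V ?_
      ⟨_, _, lift _ _ y1, by omega, y3⟩ ⟨_, _, lift _ _ z1, by omega, z3⟩
      ⟨_, _, lift _ _ w1, by omega, w3⟩
    intro s d hs hd
    exact NE _ _ (hV _ _ hs) (by omega)
  · push Not at NE SE
    apply hc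
    apply hp.right
    intro s d hs hd
    have := NE _ _ hs
    have := SE _ _ hs
    omega
  · push Not at NE SW
    exact cA P e1 e2 (by omega) h hq NE SW NW SE
  · push Not at NE SE
    apply hc
    apply hp.right
    intro s d hs hd
    have := NE _ _ hs
    have := SE _ _ hs
    omega
  · -- NW missing
    push Not at NW
    obtain ⟨s0, d0, w1, w2, w3⟩ := NE
    obtain ⟨s2, d2, y1, y2, y3⟩ := SW
    obtain ⟨s3, d3, z1, z2, z3⟩ := SE
    refine cDH P.V (P.k - 1 - e1) e2 (by show P.l + 1 ≤ N; omega) h.flipV hq.V ?_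
      ⟨_, _, lift _ _ y1, by omega, y3⟩ ⟨_, _, lift _ _ z1, by omega, z3⟩
      ⟨_, _, lift _ _ w1, by omega, w3⟩
    intro s d hs hd
    exact NW _ _ (hV _ _ hs) (by omega)
  · -- NE, SW
    push Not at NW SE
    obtain ⟨s0, d0, w1, w2, w3⟩ := NE
    obtain ⟨s2, d2, y1, y2, y3⟩ := SW
    refine cA P.V (P.k - 1 - e1) e2 (by show P.l + 1 ≤ N; omega) h.flipV hq.V ?_ ?_
      ⟨_, _, lift _ _ y1, by omega, y3⟩ ⟨_, _, lift _ _ w1, by omega, w3⟩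
    · intro s d hs hd
      exact SE _ _ (hV _ _ hs) (by omega)
    · intro s d hs hd
      exact NW _ _ (hV _ _ hs) (by omega)
  · push Not at NW SW
    apply hc
    apply hp.left
    intro s d hs hd
    have := NW _ _ hs
    have := SW _ _ hs
    omega
  · push Not at NW SW
    apply hc
    apply hp.left
    intro s d hs hd
    have := NW _ _ hs
    have := SW _ _ hs
    omega
  · -- SW, SE
    push Not at NW NE
    obtain ⟨s0, d0, w1, w2, w3⟩ := SW
    obtain ⟨s2, d2, y1, y2, y3⟩ := SE
    refine h.flipV.caseB hN hq.V ?_ (lift _ _ w1) (by omega) w3 (lift _ _ y1) (by omega) y3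
    intro s d hs hd
    have := NW _ _ (hV _ _ hs) (by omega)
    have := NE _ _ (hV _ _ hs) (by omega)
    omega
  · push Not at NE SE
    apply hc
    apply hp.right
    intro s d hs hd
    have := NE _ _ hs
    have := SE _ _ hs
    omega
  · push Not at NW SW
    apply hc
    apply hp.left
    intro s d hs hd
    have := NW _ _ hs
    have := SW _ _ hs
    omega
  · push Not at NW SW
    apply hc
    apply hp.left
    intro s d hs hd
    have := NW _ _ hs
    have := SW _ _ hs
    omega

end IMP
namespace IMP

theorem blk {i j L a b : ℤ} (hL : 0 < L) (h : a + i * L ≤ b + j * L) (hab : b - a < L) :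
    i ≤ j := by
  by_contra hc
  have : (j + 1) * L ≤ i * L := mul_le_mul_of_nonneg_right (by omega) hL.le
  rw [add_mul, one_mul] at this
  omega

theorem conf_of {P : Pat} {s1 d1 s2 d2 s3 d3 : ℤ} (h1 : P.E s1 d1) (h2 : P.E s2 d2)
    (h3 : P.E s3 d3) (h12 : s1 < s2) (h23 : s2 < s3) (hd1 : d2 < d1) (hd2 : d1 < d3)
    (N : ℤ) (hN : 1 ≤ N) : Conf N P s1 d1 := by
  have p1 := P.hE _ _ h1
  have p2 := P.hE _ _ h2
  have p3 := P.hE _ _ h3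
  obtain ⟨K, hK⟩ : ∃ K, K = s3 - s1 := ⟨_, rfl⟩
  obtain ⟨L, hL⟩ : ∃ L, L = d3 - d2 + 1 := ⟨_, rfl⟩
  obtain ⟨V, hV⟩ : ∃ V, V = (N - 1) * K := ⟨_, rfl⟩
  obtain ⟨U, hU⟩ : ∃ U, U = (N - 1) * L := ⟨_, rfl⟩
  have hK0 : 0 < K := by omega
  have hL0 : 0 < L := by omega
  have hV0 : 0 ≤ V := by rw [hV]; exact mul_nonneg (by omega) (by omega)
  have hU0 : 0 ≤ U := by rw [hU]; exact mul_nonneg (by omega) (by omega)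
  obtain ⟨S, hS⟩ : ∃ S : ℤ → ℤ → Prop, S = fun y x => y < s1 ∨ s3 + 1 + V ≤ y ∨ x < d2 ∨
    d3 + 1 + U ≤ x ∨ (y = s1 ∧ ∀ i, 0 ≤ i → i < N → x ≠ d1 + i * L) ∨
    ∃ i s d, 0 ≤ i ∧ i < N ∧ P.E s d ∧ s1 < s ∧ s ≤ s3 ∧ d2 ≤ d ∧ d ≤ d3 ∧
      y = s + (N - 1 - i) * K ∧ x = d + i * L := ⟨_, rfl⟩
  refine ⟨h1, 0, P.k + V, 0, P.l + U, S, s1, fun i => d1 + i * L, fun i => d2 + i * L, ?_, ?_, ?_⟩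
  · rintro ⟨R, C, hR, hC, hE⟩
    have r1 := hR.lo s1 (by omega) (by omega)
    have r2 := hR.hi (s3 + 1) (by omega) (by omega)
    have c1 := hC.lo d2 (by omega) (by omega)
    have c2 := hC.hi (d3 + 1) (by omega) (by omega)
    have mR := hR.mono
    have mC := hC.mono
    have e1 := mR s1 s2 (by omega) (by omega) (by omega)
    have e2 := mR (s1 + 1) s2 (by omega) (by omega) (by omega)
    have e3 := mR (s2 + 1) s3 (by omega) (by omega) (by omega)
    have e4 := mR (s1 + 1) s3 (by omega) (by omega) (by omega)
    have e5 := mC (d2 + 1) d1 (by omega) (by omega) (by omega)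
    have e6 := mC (d1 + 1) d3 (by omega) (by omega) (by omega)
    obtain ⟨y1, x1, a1, a2, a3, a4, a5⟩ := hE _ _ h1
    obtain ⟨y2, x2, b1, b2, b3, b4, b5⟩ := hE _ _ h2
    obtain ⟨y3, x3, f1, f2, f3, f4, f5⟩ := hE _ _ h3
    rw [hS] at a5 b5 f5
    obtain ⟨i, s, d, i0, i1, -, i2, i3, i4, i5, i6, i7⟩ : ∃ i s d, 0 ≤ i ∧ i < N ∧ P.E s d ∧
        s1 < s ∧ s ≤ s3 ∧ d2 ≤ d ∧ d ≤ d3 ∧ y2 = s + (N - 1 - i) * K ∧ x2 = d + i * L := by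
      rcases b5 with h | h | h | h | h | h
      · omega
      · omega
      · omega
      · omega
      · omega
      · exact h
    obtain ⟨i', s', d', i0', i1', -, i2', i3', i4', i5', i6', i7'⟩ : ∃ i s d, 0 ≤ i ∧ i < N ∧
        P.E s d ∧ s1 < s ∧ s ≤ s3 ∧ d2 ≤ d ∧ d ≤ d3 ∧ y3 = s + (N - 1 - i) * K ∧
        x3 = d + i * L := by
      rcases f5 with h | h | h | h | h | h
      · omega
      · omega
      · omega
      · omega
      · omega
      · exact h
    have q1 := blk (i := N - 1 - i) (j := N - 1 - i') (a := s) (b := s') hK0 (by omega) (by omega)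
    have q2 := blk (i := i) (j := i') (a := d) (b := d') hL0 (by omega) (by omega)
    have q3 : i' = i := by omega
    subst q3
    rcases a5 with h | h | h | h | ⟨_, h⟩ | ⟨j, s'', d'', j0, j1, -, j2, j3, j4, j5, j6, j7⟩
    · omega
    · omega
    · omega
    · omega
    · have := h i' i0 i1
      omega
    · have q1 := blk (i := i') (j := j) (a := d) (b := d'') hL0 (by omega) (by omega)
      have q2 := blk (i := j) (j := i') (a := d'') (b := d') hL0 (by omega) (by omega)
      have q3 : j = i' := by omega
      subst q3
      omega
  · intro i h0 h1
    rw [hS]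
    right; right; right; right; left
    refine ⟨rfl, ?_⟩
    intro j j0 j1 heq
    replace heq : d2 + i * L = d1 + j * L := heq
    have q1 := blk (i := i) (j := j) (a := d2) (b := d1) hL0 (by omega) (by omega)
    have q2 := blk (i := j) (j := i) (a := d1) (b := d2) hL0 (by omega) (by omega)
    have q3 : i = j := by omega
    subst q3
    omega
  · intro i h0 hi
    refine ⟨?_, ?_, ?_⟩
    · show d2 + i * L < d1 + i * L
      omega
    · show d1 + i * L < d2 + (i + 1) * L
      rw [add_mul, one_mul]; omega
    obtain ⟨v, hv⟩ : ∃ v, v = (N - 1 - i) * K := ⟨_, rfl⟩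
    obtain ⟨u, hu⟩ : ∃ u, u = i * L := ⟨_, rfl⟩
    have hv0 : 0 ≤ v := by rw [hv]; exact mul_nonneg (by omega) (by omega)
    have hu0 : 0 ≤ u := by rw [hu]; exact mul_nonneg (by omega) (by omega)
    have hv1 : v ≤ V := by rw [hv, hV]; exact mul_le_mul_of_nonneg_right (by omega) (by omega)
    have hu1 : u ≤ U := by rw [hu, hU]; exact mul_le_mul_of_nonneg_right (by omega) (by omega)
    obtain ⟨R, hR⟩ : ∃ R : ℤ → ℤ, R = fun s => if s ≤ s1 then s else if s ≤ s3 then s + v else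
      s + V := ⟨_, rfl⟩
    obtain ⟨C, hC⟩ : ∃ C : ℤ → ℤ, C = fun s => if s < d2 then s else if s ≤ d3 then s + u else
      s + U := ⟨_, rfl⟩
    have R1 : ∀ s, s ≤ s1 → R s = s := by intro s hs; simp [hR, hs]
    have R2 : ∀ s, s1 < s → s ≤ s3 → R s = s + v := by
      intro s hs hs'; simp [hR, not_le.mpr hs, hs']
    have R3 : ∀ s, s3 < s → R s = s + V := by
      intro s hs; simp [hR, not_le.mpr hs, show ¬ s ≤ s1 by omega]
    have C1 : ∀ s, s < d2 → C s = s := by intro s hs; simp [hC, hs]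
    have C2 : ∀ s, d2 ≤ s → s ≤ d3 → C s = s + u := by
      intro s hs hs'; simp [hC, not_lt.mpr hs, hs']
    have C3 : ∀ s, d3 < s → C s = s + U := by
      intro s hs; simp [hC, not_le.mpr hs, show ¬ s < d2 by omega]
    have Ri : ∀ s, R s < R (s + 1) := by
      intro s
      rw [hR]; beta_reduce; split_ifs <;> omega
    have Ci : ∀ s, C s < C (s + 1) := by
      intro s
      rw [hC]; beta_reduce; split_ifs <;> omega
    refine ⟨R, C, ⟨fun s _ _ => Ri s, ?_, ?_⟩, ⟨fun s _ _ => Ci s, ?_, ?_⟩, ?_, ?_, ?_, ?_, ?_⟩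
    · rw [R1 0 (by omega)]
    · rw [R3 _ (by omega)]
    · rcases lt_or_ge 0 d2 with h | h
      · rw [C1 0 h]
      · rw [C2 0 h (by omega)]; omega
    · rw [C3 _ (by omega)]
    · intro s d hs hne
      have ps := P.hE _ _ hs
      refine ⟨R s, C d, le_rfl, Ri s, le_rfl, Ci d, ?_⟩
      rw [hS]
      rcases lt_or_ge d d2 with e | e
      · right; right; left; rw [C1 d e]; exact e
      rcases lt_or_ge d3 d with e' | e'
      · right; right; right; left; rw [C3 d e']; omega
      rcases lt_trichotomy s s1 with e3 | rfl | e3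
      · left; rw [R1 s (by omega)]; exact e3
      · right; right; right; right; left
        refine ⟨R1 s le_rfl, ?_⟩
        intro j j0 j1 heq
        rw [C2 d e e', hu] at heq
        have q1 := blk (i := i) (j := j) (a := d) (b := d1) hL0 (by omega) (by omega)
        have q2 := blk (i := j) (j := i) (a := d1) (b := d) hL0 (by omega) (by omega)
        have q3 : i = j := by omega
        subst q3
        omega
      · rcases lt_or_ge s3 s with e4 | e4
        · right; left; rw [R3 s e4]; omega
        · right; right; right; right; right
          exact ⟨i, s, d, h0, hi, hs, e3, e4, e, e', by rw [R2 s e3 e4, hv], by rw [C2 d e e', hu]⟩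
    · rw [R1 s1 le_rfl]
    · rw [R2 _ (by omega) (by omega)]; omega
    · rw [C2 _ (by omega) (by omega), hu]
    · have := Ci d1
      rw [C2 d1 (by omega) (by omega), hu] at this
      exact this

theorem Pat.HH (P : Pat) : P.H.H = P := by
  obtain ⟨k, l, E, h⟩ := P
  simp [Pat.H]

theorem Pat.VV (P : Pat) : P.V.V = P := by
  obtain ⟨k, l, E, h⟩ := P
  simp [Pat.V]

theorem conf_of' {P : Pat} {s1 d1 s2 d2 s3 d3 : ℤ} (h1 : P.E s1 d1) (h2 : P.E s2 d2)
    (h3 : P.E s3 d3) (h12 : s1 < s2) (h23 : s2 < s3)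
    (hd : (d2 < d1 ∧ d1 < d3) ∨ (d3 < d1 ∧ d1 < d2)) :
    ∃ e1 e2, ∀ N, 1 ≤ N → Conf N P e1 e2 := by
  rcases hd with ⟨a, b⟩ | ⟨a, b⟩
  · exact ⟨_, _, fun N hN => conf_of h1 h2 h3 h12 h23 a b N hN⟩
  · have lift : ∀ s d, P.E s d → P.H.E s (P.l - 1 - d) := by
      intro s d hs
      show P.E s (P.l - 1 - (P.l - 1 - d))
      rw [sub_sub_cancel]; exact hs
    refine ⟨s1, P.l - 1 - (P.l - 1 - d1), fun N hN => ?_⟩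
    have := (conf_of (lift _ _ h1) (lift _ _ h2) (lift _ _ h3) h12 h23 (by omega) (by omega)
      N hN).flipH
    rw [Pat.HH] at this
    exact this

theorem conf_of_not_qf {P : Pat} (h : ¬ QF P) : ∃ e1 e2, ∀ N, 1 ≤ N → Conf N P e1 e2 := by
  unfold QF at h
  push Not at h
  obtain ⟨s1, d1, s2, d2, s3, d3, h1, h2, h3, h12, h23, a, b, c, x, y⟩ := h
  by_cases hc : (d2 < d1 ∧ d1 < d3) ∨ (d3 < d1 ∧ d1 < d2)
  · exact conf_of' h1 h2 h3 h12 h23 hc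
  · have lift : ∀ s d, P.E s d → P.V.E (P.k - 1 - s) d := by
      intro s d hs
      show P.E (P.k - 1 - (P.k - 1 - s)) d
      rw [sub_sub_cancel]; exact hs
    obtain ⟨e1, e2, he⟩ := conf_of' (lift _ _ h3) (lift _ _ h2) (lift _ _ h1) (by omega)
      (by omega) (by omega)
    refine ⟨P.k - 1 - e1, e2, fun N hN => ?_⟩
    have := (he N hN).flipV
    rw [Pat.VV] at this
    exact this

end IMP
namespace IMP

/-! ### Interval minors versus partitions -/

theorem pc_mono (g : ℕ → ℕ) (k : ℕ) (h : ∀ s, s < k → g s < g (s + 1)) :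
    ∀ a b, a ≤ b → b ≤ k → g a + (b - a) ≤ g b := by
  intro a b hab
  induction b, hab using Nat.le_induction with
  | base => intro _; omega
  | succ n hn ih =>
    intro hk
    have := ih (by omega)
    have := h n (by omega)
    omega

theorem pc_trans {M M' P : BMat} (h1 : PartitionContains M M') (h2 : PartitionContains M' P) :
    PartitionContains M P := by
  obtain ⟨r, c, a1, a2, a3, a4, a5⟩ := h1
  obtain ⟨r', c', b1, b2, b3, b4, b5⟩ := h2
  have m1 := pc_mono r M'.m a1
  have m2 := pc_mono c M'.n a2
  have m1' := pc_mono r' P.m b1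
  have m2' := pc_mono c' P.n b2
  refine ⟨r ∘ r', c ∘ c', ?_, ?_, ?_, ?_, ?_⟩
  · intro i hi
    have := b1 i hi
    have := m1' (i + 1) P.m (by omega) le_rfl
    have := m1 (r' i) (r' (i + 1)) (by omega) (by omega)
    simp only [Function.comp]; omega
  · intro i hi
    have := b2 i hi
    have := m2' (i + 1) P.n (by omega) le_rfl
    have := m2 (c' i) (c' (i + 1)) (by omega) (by omega)
    simp only [Function.comp]; omega
  · have := m1 (r' P.m) M'.m b3 le_rfl
    simp only [Function.comp]; omega
  · have := m2 (c' P.n) M'.n b4 le_rfl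
    simp only [Function.comp]; omega
  · intro i j hi hj hP
    obtain ⟨x, y, e1, e2, e3, e4, e5⟩ := b5 i j hi hj hP
    have q1 := m1' (i + 1) P.m (by omega) le_rfl
    have q2 := m2' (j + 1) P.n (by omega) le_rfl
    obtain ⟨x', y', f1, f2, f3, f4, f5⟩ := a5 x y (by omega) (by omega) e5
    have := m1 (r' i) x (by omega) (by omega)
    have := m1 (x + 1) (r' (i + 1)) (by omega) (by omega)
    have := m2 (c' j) y (by omega) (by omega)
    have := m2 (y + 1) (c' (j + 1)) (by omega) (by omega)
    refine ⟨x', y', ?_, ?_, ?_, ?_, f5⟩ <;> simp only [Function.comp] <;> omega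

theorem pc_tr {M P : BMat} (h : PartitionContains M P) :
    PartitionContains (transposeB M) (transposeB P) := by
  obtain ⟨r, c, a1, a2, a3, a4, a5⟩ := h
  refine ⟨c, r, a2, a1, a4, a3, ?_⟩
  intro i j hi hj hP
  obtain ⟨x, y, e1, e2, e3, e4, e5⟩ := a5 j i hj hi hP
  exact ⟨y, x, e3, e4, e1, e2, e5⟩

theorem rowCon_tr {M M' : BMat} (h : RowCon M M') : ColCon (transposeB M) (transposeB M') := by
  obtain ⟨r, h1, h2, h3, h4⟩ := h
  exact ⟨r, h1, h2, h3, fun i j hi hj => h4 j i hj hi⟩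

theorem colCon_tr {M M' : BMat} (h : ColCon M M') : RowCon (transposeB M) (transposeB M') := by
  obtain ⟨r, h1, h2, h3, h4⟩ := h
  exact ⟨r, h1, h2, h3, fun i j hi hj => h4 j i hj hi⟩

theorem con_tr {M M' : BMat} (h : Con M M') : Con (transposeB M) (transposeB M') := by
  rcases h with h | h
  · exact Or.inr (rowCon_tr h)
  · exact Or.inl (colCon_tr h)

theorem im_tr {P M : BMat} (h : IntervalMinor P M) :
    IntervalMinor (transposeB P) (transposeB M) := by
  obtain ⟨M', h1, h2, h3, h4⟩ := h
  exact ⟨transposeB M', h1.lift transposeB (fun _ _ => con_tr), h3, h2,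
    fun i j hi hj hP => h4 j i hj hi hP⟩

theorem pc_rowCon {M M' : BMat} (h : RowCon M M') : PartitionContains M M' := by
  obtain ⟨r, h1, h2, h3, h4⟩ := h
  refine ⟨fun i => if i ≤ r then i else i + 1, fun j => j, ?_, ?_, ?_, ?_, ?_⟩
  · intro i hi
    beta_reduce
    split_ifs <;> omega
  · intro j hj; beta_reduce; omega
  · beta_reduce; split_ifs <;> omega
  · beta_reduce; omega
  · intro i j hi hj hP
    rw [h4 i j hi hj] at hP
    beta_reduce
    rcases lt_trichotomy i r with hir | rfl | hir
    · rw [if_pos hir] at hP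
      exact ⟨i, j, by split_ifs <;> omega, by split_ifs <;> omega, le_rfl, by omega, hP⟩
    · simp only [lt_self_iff_false, if_false, if_true, Bool.or_eq_true] at hP
      rcases hP with hP | hP
      · exact ⟨i, j, by split_ifs <;> omega, by split_ifs <;> omega, le_rfl, by omega, hP⟩
      · exact ⟨i + 1, j, by split_ifs <;> omega, by split_ifs <;> omega, le_rfl, by omega, hP⟩
    · rw [if_neg (by omega), if_neg (by omega)] at hP
      exact ⟨i + 1, j, by split_ifs <;> omega, by split_ifs <;> omega, le_rfl, by omega, hP⟩

theorem pc_con {M M' : BMat} (h : Con M M') : PartitionContains M M' := by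
  rcases h with h | h
  · exact pc_rowCon h
  · exact pc_tr (pc_rowCon (colCon_tr h))

theorem pc_dom {M P : BMat} (h1 : M.m = P.m) (h2 : M.n = P.n)
    (h : ∀ i j, i < P.m → j < P.n → P.entry i j = true → M.entry i j = true) :
    PartitionContains M P :=
  ⟨fun i => i, fun j => j, fun i _ => Nat.lt_succ_self i, fun i _ => Nat.lt_succ_self i, h1.ge,
    h2.ge, fun i j hi hj hP => ⟨i, j, le_rfl, Nat.lt_succ_self i, le_rfl, Nat.lt_succ_self j,
      h i j hi hj hP⟩⟩

theorem pc_of_im {P M : BMat} (h : IntervalMinor P M) :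
    PartitionContains M P ∧ (P.m = 0 → M.m = 0) ∧ (P.n = 0 → M.n = 0) := by
  obtain ⟨M', h1, h2, h3, h4⟩ := h
  induction h1 using Relation.ReflTransGen.head_induction_on with
  | refl => exact ⟨pc_dom h2 h3 h4, by omega, by omega⟩
  | head hcon _ ih =>
    refine ⟨pc_trans (pc_con hcon) ih.1, ?_, ?_⟩
    · intro h0
      have := ih.2.1 h0
      rcases hcon with ⟨r, a, b, c, d⟩ | ⟨r, a, b, c, d⟩ <;> omega
    · intro h0
      have := ih.2.2 h0
      rcases hcon with ⟨r, a, b, c, d⟩ | ⟨r, a, b, c, d⟩ <;> omega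

theorem row_step {M P : BMat} (h : PartitionContains M P) (h0 : 0 < P.m) (hlt : P.m < M.m) :
    ∃ M', RowCon M M' ∧ PartitionContains M' P := by
  obtain ⟨r0, c, a1, a2, a3, a4, a5⟩ := h
  have m0 := pc_mono r0 P.m a1
  -- normalise
  obtain ⟨r, b1, b2, b3, b5⟩ : ∃ r : ℕ → ℕ, (∀ i, i < P.m → r i < r (i + 1)) ∧ r 0 = 0 ∧
      r P.m = M.m ∧ ∀ i, i < P.m → r i ≤ r0 i ∧ r0 (i + 1) ≤ r (i + 1) := by
    refine ⟨fun i => if i = 0 then 0 else if i < P.m then r0 i else M.m, ?_, ?_, ?_, ?_⟩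
    · intro i hi
      have := a1 i hi
      have := m0 (i + 1) P.m (by omega) le_rfl
      beta_reduce
      rw [if_neg (show ¬ (i + 1 = 0) by omega)]
      split_ifs <;> omega
    · simp
    · beta_reduce; split_ifs <;> omega
    · intro i hi
      have := m0 (i + 1) P.m (by omega) le_rfl
      beta_reduce
      rw [if_neg (show ¬ (i + 1 = 0) by omega)]
      split_ifs <;> omega
  have m1 := pc_mono r P.m b1
  obtain ⟨i, hi, hi2⟩ : ∃ i, i < P.m ∧ r i + 2 ≤ r (i + 1) := by
    by_contra hcon
    push Not at hcon
    have : ∀ j, j ≤ P.m → r j ≤ j := by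
      intro j
      induction j with
      | zero => intro _; omega
      | succ n ih =>
        intro hn
        have := ih (by omega)
        have := hcon n (by omega)
        omega
    have := this P.m le_rfl
    omega
  have q1 := m1 (i + 1) P.m (by omega) le_rfl
  refine ⟨⟨M.m - 1, M.n, fun a j => if a < r i then M.entry a j
        else if a = r i then (M.entry (r i) j || M.entry (r i + 1) j)
        else M.entry (a + 1) j⟩, ⟨r i, by omega, ?_, rfl, fun _ _ _ _ => rfl⟩, ?_⟩
  · show M.m - 1 + 1 = M.m; omega
  · refine ⟨fun j => if j ≤ i then r j else r j - 1, c, ?_, a2, ?_, a4, ?_⟩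
    · intro j hj
      have := b1 j hj
      beta_reduce
      by_cases hji : j = i
      · subst hji
        rw [if_pos le_rfl, if_neg (by omega)]; omega
      · by_cases hj' : j < i
        · rw [if_pos (by omega), if_pos (by omega)]; omega
        · rw [if_neg (by omega), if_neg (by omega)]
          have := m1 (i + 1) j (by omega) (by omega)
          omega
    · show (if P.m ≤ i then r P.m else r P.m - 1) ≤ M.m - 1
      rw [if_neg (by omega)]; omega
    · intro j d hj hd hP
      obtain ⟨x, y, e1, e2, e3, e4, e5⟩ := a5 j d hj hd hP
      have w := b5 j hj
      rcases lt_trichotomy j i with hji | rfl | hji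
      · have := m1 (j + 1) i (by omega) (by omega)
        refine ⟨x, y, ?_, ?_, e3, e4, ?_⟩
        · show (if j ≤ i then r j else r j - 1) ≤ x
          rw [if_pos (by omega)]; omega
        · show x < (if j + 1 ≤ i then r (j + 1) else r (j + 1) - 1)
          rw [if_pos (by omega)]; omega
        · show (if x < r i then M.entry x y
            else if x = r i then (M.entry (r i) y || M.entry (r i + 1) y)
            else M.entry (x + 1) y) = true
          rw [if_pos (by omega)]; exact e5
      · by_cases hx : x ≤ r j + 1
        · refine ⟨r j, y, ?_, ?_, e3, e4, ?_⟩
          · show (if j ≤ j then r j else r j - 1) ≤ r j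
            rw [if_pos le_rfl]
          · show r j < (if j + 1 ≤ j then r (j + 1) else r (j + 1) - 1)
            rw [if_neg (by omega)]; omega
          · show (if r j < r j then M.entry (r j) y
              else if r j = r j then (M.entry (r j) y || M.entry (r j + 1) y)
              else M.entry (r j + 1) y) = true
            rw [if_neg (by omega), if_pos rfl, Bool.or_eq_true]
            have : x = r j ∨ x = r j + 1 := by omega
            rcases this with rfl | rfl
            · exact Or.inl e5
            · exact Or.inr e5
        · refine ⟨x - 1, y, ?_, ?_, e3, e4, ?_⟩
          · show (if j ≤ j then r j else r j - 1) ≤ x - 1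
            rw [if_pos le_rfl]; omega
          · show x - 1 < (if j + 1 ≤ j then r (j + 1) else r (j + 1) - 1)
            rw [if_neg (by omega)]; omega
          · show (if x - 1 < r j then M.entry (x - 1) y
              else if x - 1 = r j then (M.entry (r j) y || M.entry (r j + 1) y)
              else M.entry (x - 1 + 1) y) = true
            rw [if_neg (by omega), if_neg (by omega), show x - 1 + 1 = x by omega]; exact e5
      · have := m1 (i + 1) j (by omega) (by omega)
        refine ⟨x - 1, y, ?_, ?_, e3, e4, ?_⟩
        · show (if j ≤ i then r j else r j - 1) ≤ x - 1
          rw [if_neg (by omega)]; omega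
        · show x - 1 < (if j + 1 ≤ i then r (j + 1) else r (j + 1) - 1)
          rw [if_neg (by omega)]; omega
        · show (if x - 1 < r i then M.entry (x - 1) y
              else if x - 1 = r i then (M.entry (r i) y || M.entry (r i + 1) y)
              else M.entry (x - 1 + 1) y) = true
          rw [if_neg (by omega), if_neg (by omega), show x - 1 + 1 = x by omega]; exact e5

theorem im_of_pc_aux (P : BMat) : ∀ (z : ℕ) (M : BMat), M.m + M.n = z → PartitionContains M P →
    (P.m = 0 → M.m = 0) → (P.n = 0 → M.n = 0) → IntervalMinor P M := by
  intro z
  induction z with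
  | zero =>
    intro M hz h _ _
    obtain ⟨r, c, a1, a2, a3, a4, a5⟩ := h
    have m1 := pc_mono r P.m a1 0 P.m (by omega) le_rfl
    have m2 := pc_mono c P.n a2 0 P.n (by omega) le_rfl
    exact ⟨M, .refl, by omega, by omega, fun i j hi hj => by omega⟩
  | succ z ih =>
    intro M hz h h1 h2
    by_cases hm : P.m < M.m
    · obtain ⟨M', hc, hp⟩ := row_step h (by omega) hm
      have hc' := hc
      obtain ⟨_, b1, b2, b3, _⟩ := hc'
      obtain ⟨M'', k1, k2⟩ := ih M' (by omega) hp (by omega) (by omega)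
      exact ⟨M'', .head (Or.inl hc) k1, k2⟩
    by_cases hn : P.n < M.n
    · obtain ⟨M', hc, hp⟩ := row_step (pc_tr h) (show 0 < P.n by omega) hn
      have hc' := rowCon_tr hc
      have hp' := pc_tr hp
      obtain ⟨q, b1, b2, b3, _⟩ := rowCon_tr hc
      change q + 1 < M.n at b1
      change (transposeB M').n + 1 = M.n at b2
      change (transposeB M').m = M.m at b3
      obtain ⟨M'', k1, k2⟩ := ih (transposeB M') (by omega) hp' (by omega) (by omega)
      exact ⟨M'', .head (Or.inr hc') k1, k2⟩
    obtain ⟨r, c, a1, a2, a3, a4, a5⟩ := h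
    have m1 := pc_mono r P.m a1
    have m2 := pc_mono c P.n a2
    have := m1 0 P.m (by omega) le_rfl
    have := m2 0 P.n (by omega) le_rfl
    refine ⟨M, .refl, by omega, by omega, ?_⟩
    intro i j hi hj hP
    obtain ⟨x, y, e1, e2, e3, e4, e5⟩ := a5 i j hi hj hP
    have := m1 0 i (by omega) (by omega)
    have := m1 (i + 1) P.m (by omega) (by omega)
    have := m2 0 j (by omega) (by omega)
    have := m2 (j + 1) P.n (by omega) (by omega)
    have hx : x = i := by omega
    have hy : y = j := by omega
    subst hx hy
    exact e5

theorem im_iff (P M : BMat) : IntervalMinor P M ↔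
    PartitionContains M P ∧ (P.m = 0 → M.m = 0) ∧ (P.n = 0 → M.n = 0) :=
  ⟨pc_of_im, fun h => im_of_pc_aux P _ M rfl h.1 h.2.1 h.2.2⟩

end IMP
namespace IMP

/-! ### From binary matrices to patterns -/

def toPat (P : BMat) : Pat :=
  ⟨P.m, P.n, fun s d => 0 ≤ s ∧ s < P.m ∧ 0 ≤ d ∧ d < P.n ∧ P.entry s.toNat d.toNat = true,
    fun _ _ h => ⟨h.1, h.2.1, h.2.2.1, h.2.2.2.1⟩⟩

def matS (M : BMat) (t l : ℤ) : ℤ → ℤ → Prop :=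
  fun y x => M.entry (y - t).toNat (x - l).toNat = true

theorem cont_of_pc {M P : BMat} (t l : ℤ) (h : PartitionContains M P) :
    Cont (toPat P) t (t + M.m) l (l + M.n) (matS M t l) := by
  obtain ⟨r, c, a1, a2, a3, a4, a5⟩ := h
  refine ⟨fun s => t + r s.toNat, fun s => l + c s.toNat, ⟨?_, ?_, ?_⟩, ⟨?_, ?_, ?_⟩, ?_⟩
  · intro s hs hk
    change s < P.m at hk
    have := a1 s.toNat (by omega)
    beta_reduce
    rw [show (s + 1).toNat = s.toNat + 1 by omega]
    omega
  · beta_reduce; omega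
  · show t + (r (P.m : ℤ).toNat : ℤ) ≤ t + M.m
    rw [Int.toNat_natCast]; omega
  · intro s hs hk
    change s < P.n at hk
    have := a2 s.toNat (by omega)
    beta_reduce
    rw [show (s + 1).toNat = s.toNat + 1 by omega]
    omega
  · beta_reduce; omega
  · show l + (c (P.n : ℤ).toNat : ℤ) ≤ l + M.n
    rw [Int.toNat_natCast]; omega
  · rintro s d ⟨b1, b2, b3, b4, b5⟩
    obtain ⟨x, y, e1, e2, e3, e4, e5⟩ := a5 s.toNat d.toNat (by omega) (by omega) b5
    refine ⟨t + x, l + y, ?_, ?_, ?_, ?_, ?_⟩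
    · beta_reduce; omega
    · beta_reduce; rw [show (s + 1).toNat = s.toNat + 1 by omega]; omega
    · beta_reduce; omega
    · beta_reduce; rw [show (d + 1).toNat = d.toNat + 1 by omega]; omega
    · unfold matS
      rw [show (t + x - t).toNat = x by omega, show (l + y - l).toNat = y by omega]
      exact e5

theorem pc_of_cont {M P : BMat} (t l : ℤ)
    (h : Cont (toPat P) t (t + M.m) l (l + M.n) (matS M t l)) : PartitionContains M P := by
  obtain ⟨R, C, hR, hC, hE⟩ := h
  have lR := hR.lo
  have lC := hC.lo
  change ∀ a, 0 ≤ a → a ≤ (P.m : ℤ) → t + a ≤ R a at lR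
  change ∀ a, 0 ≤ a → a ≤ (P.n : ℤ) → l + a ≤ C a at lC
  refine ⟨fun i => (R i - t).toNat, fun i => (C i - l).toNat, ?_, ?_, ?_, ?_, ?_⟩
  · intro i hi
    have := hR.1 i (by omega) (show (i : ℤ) < P.m by omega)
    have := lR i (by omega) (by omega)
    push_cast
    omega
  · intro i hi
    have := hC.1 i (by omega) (show (i : ℤ) < P.n by omega)
    have := lC i (by omega) (by omega)
    push_cast
    omega
  · have := hR.2.2
    change R (P.m : ℤ) ≤ _ at this
    beta_reduce; omega
  · have := hC.2.2
    change C (P.n : ℤ) ≤ _ at this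
    beta_reduce; omega
  · intro i j hi hj hP
    obtain ⟨y, x, e1, e2, e3, e4, e5⟩ := hE i j ⟨by omega, by omega, by omega, by omega, by simpa using hP⟩
    have := lR i (by omega) (by omega)
    have := lC j (by omega) (by omega)
    refine ⟨(y - t).toNat, (x - l).toNat, ?_, ?_, ?_, ?_, e5⟩ <;> push_cast <;> omega

theorem near_of_cont {P : Pat} {t b l r ρ f : ℤ} {S : ℤ → ℤ → Prop} (h0 : ¬ Cont P t b l r S)
    (h : Cont P t b l r (fun y x => S y x ∨ (y = ρ ∧ x = f))) :
    ∃ e1 e2, P.E e1 e2 ∧ ∃ R C, Near P t b l r S e1 e2 ρ f R C := by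
  obtain ⟨R, C, hR, hC, hE⟩ := h
  have h1 : ∃ e1 e2, P.E e1 e2 ∧ ¬ Cell S R C e1 e2 := by
    by_contra hc
    push Not at hc
    exact h0 ⟨R, C, hR, hC, hc⟩
  obtain ⟨e1, e2, he, hn⟩ := h1
  have key : ∀ s d, P.E s d → ¬ Cell S R C s d →
      R s ≤ ρ ∧ ρ < R (s + 1) ∧ C d ≤ f ∧ f < C (d + 1) := by
    intro s d hs hn
    obtain ⟨y, x, a1, a2, a3, a4, a5⟩ := hE s d hs
    rcases a5 with a5 | ⟨rfl, rfl⟩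
    · exact absurd ⟨y, x, a1, a2, a3, a4, a5⟩ hn
    · exact ⟨a1, a2, a3, a4⟩
  have q := key e1 e2 he hn
  refine ⟨e1, e2, he, R, C, hR, hC, ?_, q⟩
  intro s d hs hne
  by_contra hn2
  have q2 := key s d hs hn2
  have b1 := P.hE _ _ he
  have b2 := P.hE _ _ hs
  apply hne
  constructor
  · rcases lt_trichotomy s e1 with h | h | h
    · have := hR.mono (s + 1) e1 (by omega) (by omega) (by omega); omega
    · exact h
    · have := hR.mono (e1 + 1) s (by omega) (by omega) (by omega); omega
  · rcases lt_trichotomy d e2 with h | h | h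
    · have := hC.mono (d + 1) e2 (by omega) (by omega) (by omega); omega
    · exact h
    · have := hC.mono (e2 + 1) d (by omega) (by omega) (by omega); omega

theorem cont_mono {P : Pat} {t b l r : ℤ} {S S' : ℤ → ℤ → Prop}
    (hS : ∀ y x, t ≤ y → y < b → l ≤ x → x < r → S y x → S' y x)
    (h : Cont P t b l r S) : Cont P t b l r S' := by
  obtain ⟨R, C, hR, hC, hE⟩ := h
  refine ⟨R, C, hR, hC, fun s d hs => ?_⟩
  obtain ⟨y, x, a1, a2, a3, a4, a5⟩ := hE s d hs
  have b1 := P.hE _ _ hs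
  have := hR.lo s (by omega) (by omega)
  have := hC.lo d (by omega) (by omega)
  have := hR.hi (s + 1) (by omega) (by omega)
  have := hC.hi (d + 1) (by omega) (by omega)
  exact ⟨y, x, a1, a2, a3, a4, hS y x (by omega) (by omega) (by omega) (by omega) a5⟩

theorem near_mono {P : Pat} {t b l r e1 e2 ρ f : ℤ} {R C : ℤ → ℤ} {S S' : ℤ → ℤ → Prop}
    (hS : ∀ y x, t ≤ y → y < b → l ≤ x → x < r → S y x → S' y x)
    (h : Near P t b l r S e1 e2 ρ f R C) : Near P t b l r S' e1 e2 ρ f R C := by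
  obtain ⟨hR, hC, hE, h4⟩ := h
  refine ⟨hR, hC, fun s d hs hne => ?_, h4⟩
  obtain ⟨y, x, a1, a2, a3, a4, a5⟩ := hE s d hs hne
  have b1 := P.hE _ _ hs
  have := hR.lo s (by omega) (by omega)
  have := hC.lo d (by omega) (by omega)
  have := hR.hi (s + 1) (by omega) (by omega)
  have := hC.hi (d + 1) (by omega) (by omega)
  exact ⟨y, x, a1, a2, a3, a4, hS y x (by omega) (by omega) (by omega) (by omega) a5⟩

/-! ### Row-boundedness from `QF` -/

theorem crit_near {P M : BMat} (h : CriticalFor (Av P) M)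
    (hz : ∃ ρ f, ρ < M.m ∧ f < M.n ∧ M.entry ρ f = false) :
    ¬ Cont (toPat P) 0 M.m 0 M.n (matS M 0 0) ∧
    ∀ ρ f, ρ < M.m → f < M.n → M.entry ρ f = false →
      ∃ e1 e2, (toPat P).E e1 e2 ∧ ∃ R C, Near (toPat P) 0 M.m 0 M.n (matS M 0 0) e1 e2 ρ f R C := by
  have hdeg : (P.m = 0 → M.m = 0) ∧ (P.n = 0 → M.n = 0) := by
    obtain ⟨ρ, f, h1, h2, h3⟩ := hz
    have := h.2 ρ f h1 h2 h3
    have := ((im_iff _ _).1 (not_not.1 this)).2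
    exact this
  have hnc : ¬ Cont (toPat P) 0 M.m 0 M.n (matS M 0 0) := by
    intro hc
    apply h.1
    rw [im_iff]
    refine ⟨pc_of_cont 0 0 ?_, hdeg⟩
    rw [zero_add, zero_add]; exact hc
  refine ⟨hnc, fun ρ f h1 h2 h3 => ?_⟩
  have h4 := ((im_iff _ _).1 (not_not.1 (h.2 ρ f h1 h2 h3))).1
  have h5 := cont_of_pc 0 0 h4
  rw [zero_add, zero_add] at h5
  refine near_of_cont hnc (cont_mono ?_ h5)
  intro y x y0 y1 x0 x1 hS
  change (if (y - 0).toNat = ρ ∧ (x - 0).toNat = f then true else M.entry (y - 0).toNat (x - 0).toNat) = true at hS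
  split_ifs at hS with hc
  · right; omega
  · left; exact hS

theorem enum_finset (s : Finset ℕ) (N : ℕ) (h : N ≤ s.card) :
    ∃ G : ℕ → ℕ, (∀ a, a < N → G a ∈ s) ∧ ∀ a b, a < b → b < N → G a < G b := by
  let F := s.orderEmbOfCardLe h
  refine ⟨fun a => if ha : a < N then F ⟨a, ha⟩ else 0, ?_, ?_⟩
  · intro a ha
    beta_reduce
    rw [dif_pos ha]
    exact s.orderEmbOfCardLe_mem h _
  · intro a b hab hb
    beta_reduce
    rw [dif_pos hb, dif_pos (hab.trans hb)]
    exact F.strictMono (by simpa using hab)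

theorem rowBounded_of_qf {P : BMat} (hq : QF (toPat P)) : RowBounded (Av P) := by
  classical
  set N := P.n * P.n + P.n + 2 with hN
  refine ⟨P.m * P.n * (N + 1), fun M hM ρ hρ => ?_⟩
  by_contra hlt
  push Not at hlt
  let s : Finset ℕ := (Finset.range M.n).filter
    (fun j => M.entry ρ j = false ∧ (j = 0 ∨ M.entry ρ (j - 1) = true))
  have hs : rowRunCount M ρ = s.card := by
    unfold rowRunCount
    rw [← Set.ncard_coe_finset]
    congr 1
    ext j
    simp [s]
  rw [hs] at hlt
  have hmem : ∀ j, j ∈ s → j < M.n ∧ M.entry ρ j = false ∧ (j = 0 ∨ M.entry ρ (j - 1) = true) := by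
    intro j hj; simpa [s] using hj
  have hz : ∃ ρ f, ρ < M.m ∧ f < M.n ∧ M.entry ρ f = false := by
    obtain ⟨j, hj⟩ := Finset.card_pos.1 (by omega : 0 < s.card)
    exact ⟨ρ, j, hρ, (hmem j hj).1, (hmem j hj).2.1⟩
  obtain ⟨hnc, hcr⟩ := crit_near hM hz
  have hch : ∀ j, ∃ e : ℤ × ℤ, j ∈ s → (toPat P).E e.1 e.2 ∧
      ∃ R C, Near (toPat P) 0 M.m 0 M.n (matS M 0 0) e.1 e.2 ρ j R C := by
    intro j
    by_cases hj : j ∈ s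
    · obtain ⟨e1, e2, h⟩ := hcr ρ j hρ (hmem j hj).1 (hmem j hj).2.1
      exact ⟨(e1, e2), fun _ => h⟩
    · exact ⟨(0, 0), fun h => absurd h hj⟩
  choose e he using hch
  obtain ⟨⟨e1, e2⟩, -, hy⟩ := Finset.exists_lt_card_fiber_of_mul_lt_card_of_maps_to
    (s := s) (t := Finset.Ico (0 : ℤ) P.m ×ˢ Finset.Ico (0 : ℤ) P.n) (f := e) (n := N + 1)
    (by
      intro j hj
      have := (toPat P).hE _ _ (he j hj).1
      simp only [Finset.mem_product, Finset.mem_Ico]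
      exact ⟨⟨this.1, this.2.1⟩, this.2.2⟩)
    (by
      rw [Finset.card_product]
      simpa using hlt)
  obtain ⟨G, g1, g2⟩ := enum_finset _ (N + 2) (by omega : N + 2 ≤ (s.filter (fun x => e x = (e1, e2))).card)
  have g3 : ∀ a, a < N + 2 → G a ∈ s ∧ e (G a) = (e1, e2) := fun a ha => by
    simpa using g1 a ha
  have hE : (toPat P).E e1 e2 := by
    have := (he _ (g3 0 (by omega)).1).1
    rw [(g3 0 (by omega)).2] at this
    exact this
  refine not_conf (N := (N : ℤ)) (P := toPat P) (e1 := e1) (e2 := e2) ⟨hE, 0, M.m, 0, M.n, matS M 0 0, ρ,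
    fun i => G (i + 1).toNat, fun i => (G (i + 1).toNat : ℤ) - 1, hnc, ?_, ?_⟩ ?_ hq
  · intro i h0 hi
    have q := hmem _ (g3 (i + 1).toNat (by omega)).1
    have := g2 0 (i + 1).toNat (by omega) (by omega)
    have q2 := q.2.2.resolve_left (by omega)
    unfold matS
    rw [show ((ρ : ℤ) - 0).toNat = ρ by omega,
      show ((G (i + 1).toNat : ℤ) - 1 - 0).toNat = G (i + 1).toNat - 1 by omega]
    exact q2
  · intro i h0 hi
    have q0 := g3 (i + 1).toNat (by omega)
    have q := hmem _ q0.1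
    have q' := hmem _ (g3 (i + 1 + 1).toNat (by omega)).1
    have l1 := g2 (i + 1).toNat (i + 1 + 1).toNat (by omega) (by omega)
    have q2 := q'.2.2.resolve_left (by omega)
    have ne : G (i + 1).toNat ≠ G (i + 1 + 1).toNat - 1 := by
      intro h
      rw [← h, q.2.1] at q2
      exact absurd q2 (by simp)
    refine ⟨by beta_reduce; omega, by beta_reduce; omega, ?_⟩
    have := (he _ q0.1).2
    rw [q0.2] at this
    exact this
  · show (P.n : ℤ) * P.n + P.n + 2 ≤ (N : ℤ)
    rw [hN]; push_cast; exact le_rfl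

end IMP
namespace IMP

/-! ### Unboundedness -/

theorem exists_crit (C : Set BMat) : ∀ (z : ℕ) (M : BMat), M ∈ C →
    ((Finset.range M.m ×ˢ Finset.range M.n).filter (fun p => M.entry p.1 p.2 = false)).card = z →
    ∃ M', CriticalFor C M' ∧ M'.m = M.m ∧ M'.n = M.n ∧
      ∀ a b, M.entry a b = true → M'.entry a b = true := by
  intro z
  induction z using Nat.strong_induction_on with
  | _ z ih =>
    intro M hM hz
    by_cases hc : CriticalFor C M
    · exact ⟨M, hc, rfl, rfl, fun _ _ h => h⟩
    · unfold CriticalFor at hc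
      push Not at hc
      obtain ⟨i, j, hi, hj, h0, h1⟩ := hc hM
      obtain ⟨M', a1, a2, a3, a4⟩ := ih _ (by
        rw [← hz]
        apply Finset.card_lt_card (s := ((Finset.range (setOne M i j).m ×ˢ Finset.range (setOne M i j).n).filter
          (fun p => (setOne M i j).entry p.1 p.2 = false)))
        rw [Finset.ssubset_iff_of_subset]
        · refine ⟨(i, j), by simp [hi, hj, h0], by simp [setOne]⟩
        · intro p hp
          rw [Finset.mem_filter] at hp ⊢
          refine ⟨hp.1, ?_⟩
          have := hp.2
          simp only [setOne] at this
          split_ifs at this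
          exact this) (setOne M i j) h1 rfl
      refine ⟨M', a1, a2, a3, fun a b hab => a4 a b ?_⟩
      simp only [setOne]
      split_ifs
      · rfl
      · exact hab

theorem run_start (w : ℕ → Bool) (a : ℕ) (ha : w a = true) : ∀ c, a < c → w c = false →
    ∃ j, a < j ∧ j ≤ c ∧ w j = false ∧ w (j - 1) = true := by
  intro c hac
  induction c, hac using Nat.le_induction with
  | base => intro h; exact ⟨a + 1, by omega, by omega, h, by simpa using ha⟩
  | succ n hn ih =>
    intro h
    cases hw : w n with
    | true => exact ⟨n + 1, by omega, by omega, h, by simpa using hw⟩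
    | false =>
      obtain ⟨j, h1, h2, h3⟩ := ih hw
      exact ⟨j, h1, by omega, h3⟩

theorem not_rowBounded_of_not_qf {P : BMat} (hq : ¬ QF (toPat P)) : ¬ RowBounded (Av P) := by
  classical
  rintro ⟨K, hK⟩
  obtain ⟨e1, e2, hconf⟩ := conf_of_not_qf hq
  obtain ⟨he, t, b, l, r, S, ρ, f, g, hnc, hg, hf⟩ := hconf (K + 3) (by omega)
  have hb := (toPat P).hE _ _ he
  change 0 ≤ e1 ∧ e1 < (P.m : ℤ) ∧ 0 ≤ e2 ∧ e2 < (P.n : ℤ) at hb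
  have hin : ∀ i, 0 ≤ i → i < (K : ℤ) + 3 → t ≤ ρ ∧ ρ < b ∧ l ≤ f i ∧ f i < r := by
    intro i h0 hi
    obtain ⟨_, _, R, C, hR, hC, _, c1, c2, c3, c4⟩ := hf i h0 hi
    have hR' : Cuts (P.m : ℤ) t b R := hR
    have hC' : Cuts (P.n : ℤ) l r C := hC
    have := hR'.lo e1 (by omega) (by omega)
    have := hR'.hi (e1 + 1) (by omega) (by omega)
    have := hC'.lo e2 (by omega) (by omega)
    have := hC'.hi (e2 + 1) (by omega) (by omega)
    omega
  have hin0 := hin 0 le_rfl (by omega)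
  let M : BMat := ⟨(b - t).toNat, (r - l).toNat, fun a c => decide (S (t + a) (l + c))⟩
  have hbm : t + ((b - t).toNat : ℤ) = b := by omega
  have hrm : l + ((r - l).toNat : ℤ) = r := by omega
  have hM : M ∈ Av P := by
    intro him
    have h1 := cont_of_pc t l ((im_iff _ _).1 him).1
    change Cont (toPat P) t (t + ((b - t).toNat : ℤ)) l (l + ((r - l).toNat : ℤ)) (matS M t l) at h1
    rw [hbm, hrm] at h1
    refine hnc (cont_mono ?_ h1)
    intro y x y0 y1 x0 x1 hS
    have hS' : S (t + ((y - t).toNat : ℤ)) (l + ((x - l).toNat : ℤ)) := of_decide_eq_true hS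
    rw [show t + ((y - t).toNat : ℤ) = y by omega, show l + ((x - l).toNat : ℤ) = x by omega] at hS'
    exact hS'
  obtain ⟨M', hcrit, hm, hn, hsub⟩ := exists_crit (Av P) _ M hM rfl
  have hm' : t + (M'.m : ℤ) = b := by rw [hm]; exact hbm
  have hn' : l + (M'.n : ℤ) = r := by rw [hn]; exact hrm
  have hSM : ∀ y x, t ≤ y → y < b → l ≤ x → x < r → S y x → matS M' t l y x := by
    intro y x y0 y1 x0 x1 hS
    apply hsub
    apply decide_eq_true
    rw [show t + ((y - t).toNat : ℤ) = y by omega, show l + ((x - l).toNat : ℤ) = x by omega]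
    exact hS
  have hnc' : ¬ Cont (toPat P) t b l r (matS M' t l) := by
    intro hc
    rw [← hm', ← hn'] at hc
    exact hcrit.1 ((im_iff _ _).2 ⟨pc_of_cont t l hc, by omega, by omega⟩)
  have hf0 : ∀ i, 0 ≤ i → i < (K : ℤ) + 3 → M'.entry (ρ - t).toNat (f i - l).toNat = false := by
    intro i h0 hi
    obtain ⟨_, _, R, C, hN⟩ := hf i h0 hi
    by_contra hc
    have hc' : matS M' t l ρ (f i) := by unfold matS; simpa using hc
    have h1 := near_mono hSM hN
    exact hnc' (h1.close hc' hN.2.2.2.2.2.1 hN.2.2.2.2.2.2)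
  have hJ : ∀ i : ℕ, ∃ j : ℕ, i < K + 1 → (g (i + 1) - l).toNat < j ∧ j ≤ (f (i + 1) - l).toNat ∧
      M'.entry (ρ - t).toNat j = false ∧ M'.entry (ρ - t).toNat (j - 1) = true := by
    intro i
    by_cases hi : i < K + 1
    · have q1 := hin i (by omega) (by omega)
      have q2 := hin (i + 1) (by omega) (by omega)
      have q3 := hf i (by omega) (by omega)
      have q4 := hf (i + 1) (by omega) (by omega)
      have q5 := hSM ρ (g (i + 1)) (by omega) (by omega) (by omega) (by omega)
        (hg (i + 1) (by omega) (by omega))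
      obtain ⟨j, hj⟩ := run_start (fun x => M'.entry (ρ - t).toNat x) _ q5 (f (i + 1) - l).toNat
        (by omega) (hf0 (i + 1) (by omega) (by omega))
      exact ⟨j, fun _ => hj⟩
    · exact ⟨0, fun h => absurd h hi⟩
  choose J hJ using hJ
  have hstep : ∀ i i' : ℕ, i < i' → i' < K + 1 → J i < J i' := by
    have hstep1 : ∀ i : ℕ, i + 1 < K + 1 → J i < J (i + 1) := by
      intro i hi
      have a1 := hJ i (by omega)
      have a2 := hJ (i + 1) (by omega)
      push_cast at a2
      have a3 := hf (i + 1) (by omega) (by omega)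
      omega
    intro i i' hii
    induction i', hii using Nat.le_induction with
    | base => exact hstep1 i
    | succ n hn ih =>
      intro h
      have := ih (by omega)
      have := hstep1 n h
      omega
  have hle := hK M' hcrit (ρ - t).toNat (by omega)
  have hbig : K + 1 ≤ rowRunCount M' (ρ - t).toNat := by
    unfold rowRunCount
    have hc : ((Finset.range (K + 1)).image J).card = K + 1 := by
      rw [Finset.card_image_of_injOn, Finset.card_range]
      intro a ha a' ha' h
      simp only [Finset.coe_range, Set.mem_Iio] at ha ha'
      rcases lt_trichotomy a a' with h1 | h1 | h1
      · have := hstep a a' h1 ha'; omega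
      · exact h1
      · have := hstep a' a h1 ha; omega
    rw [← hc, ← Set.ncard_coe_finset]
    apply Set.ncard_le_ncard
    · intro j hj
      simp only [Finset.coe_image, Finset.coe_range, Set.mem_image, Set.mem_Iio] at hj
      obtain ⟨i, hi, rfl⟩ := hj
      have q := hJ i hi
      have q2 := hin (i + 1) (by omega) (by omega)
      exact ⟨by omega, q.2.2.1, Or.inr q.2.2.2⟩
    · exact (Set.finite_Iio M'.n).subset (fun j hj => hj.1)
  omega

theorem rowBounded_iff (P : BMat) : RowBounded (Av P) ↔ QF (toPat P) :=
  ⟨fun h => by_contra fun hq => not_rowBounded_of_not_qf hq h, rowBounded_of_qf⟩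

/-! ### Transposition -/

theorem av_tr {P M : BMat} (h : M ∈ Av P) : transposeB M ∈ Av (transposeB P) :=
  fun hi => h (im_tr hi)

theorem setOne_tr (M : BMat) (i j : ℕ) :
    transposeB (setOne M i j) = setOne (transposeB M) j i := by
  simp only [transposeB, setOne, and_comm]

theorem crit_tr {P M : BMat} (h : CriticalFor (Av P) M) :
    CriticalFor (Av (transposeB P)) (transposeB M) := by
  refine ⟨av_tr h.1, fun i j hi hj h0 h1 => ?_⟩
  refine h.2 j i hj hi h0 ?_
  rw [← setOne_tr] at h1
  exact av_tr h1

theorem colBounded_iff_row (P : BMat) : ColBounded (Av P) ↔ RowBounded (Av (transposeB P)) := by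
  constructor
  · rintro ⟨K, hK⟩
    exact ⟨K, fun M hM r hr => hK (transposeB M) (crit_tr hM) r hr⟩
  · rintro ⟨K, hK⟩
    exact ⟨K, fun M hM r hr => hK (transposeB M) (crit_tr hM) r hr⟩

theorem qf_tr {P : BMat} (h : QF (toPat P)) : QF (toPat (transposeB P)) := by
  have tr : ∀ s d, (toPat (transposeB P)).E s d → (toPat P).E d s := by
    rintro s d ⟨h1, h2, h3, h4, h5⟩
    exact ⟨h3, h4, h1, h2, h5⟩
  intro s1 d1 s2 d2 s3 d3 h1 h2 h3 l1 l2 n1 n2 n3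
  have h1 := tr _ _ h1
  have h2 := tr _ _ h2
  have h3 := tr _ _ h3
  have a1 := h d1 s1 d3 s3 d2 s2 h1 h3 h2
  have a2 := h d2 s2 d1 s1 d3 s3 h2 h1 h3
  have a3 := h d2 s2 d3 s3 d1 s1 h2 h3 h1
  have a4 := h d3 s3 d1 s1 d2 s2 h3 h1 h2
  omega

theorem colBounded_iff (P : BMat) : ColBounded (Av P) ↔ QF (toPat P) := by
  rw [colBounded_iff_row, rowBounded_iff]
  exact ⟨fun h => qf_tr h, qf_tr⟩

end IMP

/-- **Corollary.** For every binary pattern `P`, the class `Av(P)` is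
row-bounded iff it is column-bounded iff it is bounded. -/
theorem stmt_1 (P : BMat) :
    List.TFAE [RowBounded (Av P), ColBounded (Av P), Bounded (Av P)] := by
  have h1 := IMP.rowBounded_iff P
  have h2 := IMP.colBounded_iff P
  tfae_have 1 ↔ 2 := h1.trans h2.symm
  tfae_have 1 → 3 := fun h => ⟨h, h2.2 (h1.1 h)⟩
  tfae_have 3 → 1 := fun h => h.1
  tfae_finish
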